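/- There exist ε₀ > 0 and C > 0 such that if f is a (1+ε)-biLipschitz self map of ℍ with ε ≤ ε₀ and f(O) = O, then for every R > 0 there exists A ∈ O(2) such that d(f(z;0), (Az; 0)) ≤ C ε^{1/16} R for every z ∈ ℂ with |z| ≤ R. -/

import Mathlib

noncomputable section

open MeasureTheory

/-- Points of the Heisenberg group `ℍ`, identified with `ℝ³ ≅ ℂ × ℝ`:
`(x, y, t)` corresponds to `(z ; t)` with `z = x + iy`. -/
abbrev H : Type := ℝ × ℝ × ℝ

/-- The Heisenberg group law
`(x,y,t)·(x',y',t') = (x+x', y+y', t+t'+2(x'y − xy'))`. -/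
def Hmul (p q : H) : H :=
  (p.1 + q.1, p.2.1 + q.2.1, p.2.2 + q.2.2 + 2 * (q.1 * p.2.1 - p.1 * q.2.1))

/-- The Heisenberg group inverse. -/
def Hinv (p : H) : H := (-p.1, -p.2.1, -p.2.2)

/-- The identity `O = (0,0,0)`. -/
def HO : H := (0, 0, 0)

/-- The control (Carnot–Carathéodory) distance: the infimum of the lengths
`∫₀¹ √(a(s)² + b(s)²) ds` of horizontal Lipschitz curves `γ` joining `P` to `Q`,
i.e. curves satisfying a.e. `γ' = a·X(γ) + b·Y(γ)` where `X = ∂ₓ + 2y∂_t` and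
`Y = ∂_y − 2x∂_t`. -/
def dH (P Q : H) : ℝ :=
  sInf { L : ℝ | ∃ (γ : ℝ → H) (a b : ℝ → ℝ) (K : NNReal),
    LipschitzWith K γ ∧ γ 0 = P ∧ γ 1 = Q ∧
    (∀ᵐ s ∂volume, s ∈ Set.Icc (0:ℝ) 1 →
      HasDerivAt γ (a s, b s, 2 * (γ s).2.1 * a s - 2 * (γ s).1 * b s) s) ∧
    IntervalIntegrable (fun s => Real.sqrt (a s ^ 2 + b s ^ 2)) volume 0 1 ∧
    L = ∫ s in (0:ℝ)..1, Real.sqrt (a s ^ 2 + b s ^ 2) }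

/-- `γ : ℝ → ℍ` is a `(1+ε)`-quasigeodesic. -/
def IsQuasiGeodesic (ε : ℝ) (γ : ℝ → H) : Prop :=
  ∀ s s' : ℝ, (1 + ε)⁻¹ * |s - s'| ≤ dH (γ s) (γ s') ∧
    dH (γ s) (γ s') ≤ (1 + ε) * |s - s'|

/-- `f : ℍ → ℍ` is `(1+ε)`-biLipschitz for the control distance. -/
def IsBiLip (ε : ℝ) (f : H → H) : Prop :=
  ∀ P Q : H, (1 + ε)⁻¹ * dH P Q ≤ dH (f P) (f Q) ∧ dH (f P) (f Q) ≤ (1 + ε) * dH P Q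

/-- `(a,b)` is the horizontal speed of `γ`: a.e. `γ'(s) = a(s)X(γ(s)) + b(s)Y(γ(s))`. -/
def HasHorizSpeed (γ : ℝ → H) (a b : ℝ → ℝ) : Prop :=
  ∀ᵐ s ∂volume, HasDerivAt γ (a s, b s, 2 * (γ s).2.1 * a s - 2 * (γ s).1 * b s) s

def HC (P Q : H) (L : ℝ) : Prop := ∃ (γ : ℝ → H) (a b : ℝ → ℝ) (K : NNReal),
    LipschitzWith K γ ∧ γ 0 = P ∧ γ 1 = Q ∧
    (∀ᵐ s ∂volume, s ∈ Set.Icc (0:ℝ) 1 →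
      HasDerivAt γ (a s, b s, 2 * (γ s).2.1 * a s - 2 * (γ s).1 * b s) s) ∧
    IntervalIntegrable (fun s => Real.sqrt (a s ^ 2 + b s ^ 2)) volume 0 1 ∧
    L = ∫ s in (0:ℝ)..1, Real.sqrt (a s ^ 2 + b s ^ 2)

theorem dH_eq (P Q : H) : dH P Q = sInf {L | HC P Q L} := rfl

theorem HC_affine (Λ : H →L[ℝ] H) (c : H) (r : ℝ) (hr : 0 ≤ r)
    (hΛ : ∀ (q : H) (a b : ℝ), Λ (a, b, 2 * q.2.1 * a - 2 * q.1 * b) =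
      (r * a, r * b, 2 * (c + Λ q).2.1 * (r * a) - 2 * (c + Λ q).1 * (r * b)))
    {P Q : H} {L : ℝ} (h : HC P Q L) : HC (c + Λ P) (c + Λ Q) (r * L) := by
  obtain ⟨γ, a, b, K, hK, h0, h1, hd, hi, hL⟩ := h
  have hsq : (fun s => Real.sqrt ((r * a s) ^ 2 + (r * b s) ^ 2)) =
      fun s => r * Real.sqrt (a s ^ 2 + b s ^ 2) := by
    funext s
    rw [show (r * a s) ^ 2 + (r * b s) ^ 2 = r ^ 2 * (a s ^ 2 + b s ^ 2) by ring,
      Real.sqrt_mul (by positivity), Real.sqrt_sq hr]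
  refine ⟨fun s => c + Λ (γ s), fun s => r * a s, fun s => r * b s, 0 + ‖Λ‖₊ * K, ?_, ?_, ?_,
    ?_, ?_, ?_⟩
  · exact (LipschitzWith.const c).add (Λ.lipschitz.comp hK)
  · simp [h0]
  · simp [h1]
  · filter_upwards [hd] with s hs hs1
    have := (Λ.hasFDerivAt.comp_hasDerivAt s (hs hs1)).const_add c
    rw [hΛ] at this
    exact this
  · rw [hsq]; exact hi.const_mul r
  · rw [hsq, intervalIntegral.integral_const_mul, hL]

theorem HC_translate (p : H) {P Q : H} {L : ℝ} (h : HC P Q L) :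
    HC (Hmul p P) (Hmul p Q) L := by
  let Λ : H →ₗ[ℝ] H :=
    { toFun := fun q => (q.1, q.2.1, q.2.2 + 2 * (q.1 * p.2.1 - p.1 * q.2.1))
      map_add' := by
        intro x y; ext <;> simp; ring
      map_smul' := by
        intro x y; ext <;> simp; ring }
  have key := HC_affine Λ.toContinuousLinearMap p 1 zero_le_one (by
    intro q a b
    ext <;> simp [Λ]
    ring) h
  have e : ∀ q, p + Λ.toContinuousLinearMap q = Hmul p q := by
    intro q; ext <;> simp [Λ, Hmul]; ring
  rw [e, e, one_mul] at key
  exact key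

/-- dilation -/
def Hdil (r : ℝ) (p : H) : H := (r * p.1, r * p.2.1, r ^ 2 * p.2.2)

theorem HC_dil (r : ℝ) (hr : 0 ≤ r) {P Q : H} {L : ℝ} (h : HC P Q L) :
    HC (Hdil r P) (Hdil r Q) (r * L) := by
  let Λ : H →ₗ[ℝ] H :=
    { toFun := fun q => Hdil r q
      map_add' := by
        intro x y; ext <;> simp [Hdil] <;> ring
      map_smul' := by
        intro x y; ext <;> simp [Hdil] <;> ring }
  have key := HC_affine Λ.toContinuousLinearMap 0 r hr (by
    intro q a b
    ext <;> simp [Λ, Hdil]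
    ring) h
  have e : ∀ q, 0 + Λ.toContinuousLinearMap q = Hdil r q := by
    intro q; simp [Λ]
  rw [e, e] at key
  exact key

theorem HC_seg (x y : ℝ) : HC HO (x, y, 0) (Real.sqrt (x ^ 2 + y ^ 2)) := by
  have hd : ∀ s : ℝ, HasDerivAt (fun s : ℝ => ((s * x, s * y, 0) : H)) (x, y, 0) s := by
    intro s
    have h1 := (hasDerivAt_id s).mul_const x
    have h2 := (hasDerivAt_id s).mul_const y
    simpa using h1.prodMk (h2.prodMk (hasDerivAt_const s (0:ℝ)))
  refine ⟨fun s => (s * x, s * y, 0), fun _ => x, fun _ => y, ‖((x, y, 0) : H)‖₊, ?_, ?_, ?_,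
    ?_, ?_, ?_⟩
  · apply lipschitzWith_of_nnnorm_deriv_le (fun s => (hd s).differentiableAt)
    intro s
    rw [(hd s).deriv]
  · simp [HO]
  · simp
  · refine Filter.Eventually.of_forall fun s _ => ?_
    have : 2 * (s * y) * x - 2 * (s * x) * y = 0 := by ring
    simp only [this]
    exact hd s
  · simp
  · simp

theorem ae_comp_affine {p : ℝ → Prop} (h : ∀ᵐ s ∂(volume : Measure ℝ), p s) (d : ℝ) :
    ∀ᵐ s ∂(volume : Measure ℝ), p (2 * s - d) := by
  rw [ae_iff] at h ⊢
  have h1 : volume ((fun x : ℝ => x - d) ⁻¹' {a | ¬ p a}) = 0 := by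
    rw [← h]
    simpa [sub_eq_add_neg] using measure_preimage_add_right (volume : Measure ℝ) (-d) {a | ¬ p a}
  have h2 := Real.volume_preimage_mul_left (a := 2) two_ne_zero
    ((fun x : ℝ => x - d) ⁻¹' {a | ¬ p a})
  rw [h1, mul_zero] at h2
  exact h2

theorem HC_concat {P Q R : H} {L L' : ℝ} (h : HC P Q L) (h' : HC Q R L') :
    HC P R (L + L') := by
  obtain ⟨γ, a, b, K, hK, h0, h1, hd, hi, hL⟩ := h
  obtain ⟨γ', a', b', K', hK', h0', h1', hd', hi', hL'⟩ := h'
  set v : ℝ → ℝ := fun s => Real.sqrt (a s ^ 2 + b s ^ 2) with hv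
  set v' : ℝ → ℝ := fun s => Real.sqrt (a' s ^ 2 + b' s ^ 2) with hv'
  let A : ℝ → ℝ := fun s => if s < 1/2 then 2 * a (2 * s) else 2 * a' (2 * s - 1)
  let B : ℝ → ℝ := fun s => if s < 1/2 then 2 * b (2 * s) else 2 * b' (2 * s - 1)
  have hV1 : ∀ s, s < 1/2 → Real.sqrt (A s ^ 2 + B s ^ 2) = 2 * v (2 * s) := by
    intro s hs
    simp only [A, B, hs, if_true, hv]
    rw [show (2 * a (2 * s)) ^ 2 + (2 * b (2 * s)) ^ 2 = 2 ^ 2 * (a (2 * s) ^ 2 + b (2 * s) ^ 2) by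
      ring, Real.sqrt_mul (by positivity), Real.sqrt_sq (by norm_num)]
  have hV2 : ∀ s, ¬ s < 1/2 → Real.sqrt (A s ^ 2 + B s ^ 2) = 2 * v' (2 * s - 1) := by
    intro s hs
    simp only [A, B, hs, if_false, hv']
    rw [show (2 * a' (2 * s - 1)) ^ 2 + (2 * b' (2 * s - 1)) ^ 2
      = 2 ^ 2 * (a' (2 * s - 1) ^ 2 + b' (2 * s - 1) ^ 2) by
      ring, Real.sqrt_mul (by positivity), Real.sqrt_sq (by norm_num)]
  have hne : ∀ᵐ s ∂(volume : Measure ℝ), s ≠ 1/2 := by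
    simp [ae_iff]
  have i1 : IntervalIntegrable (fun s => 2 * v (2 * s)) volume 0 (1/2) := by
    have := (hi.comp_mul_left (c := 2)).const_mul 2
    simpa using this
  have i2 : IntervalIntegrable (fun s => 2 * v' (2 * s - 1)) volume (1/2) 1 := by
    have h3 := (hi'.comp_sub_right 1)
    have := (h3.comp_mul_left (c := 2)).const_mul 2
    norm_num at this
    simpa using this
  have c1 : ∀ᵐ s ∂(volume : Measure ℝ), s ∈ Set.uIoc (0:ℝ) (1/2) →
      2 * v (2 * s) = Real.sqrt (A s ^ 2 + B s ^ 2) := by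
    filter_upwards [hne] with s hs hs1
    rw [Set.uIoc_of_le (by norm_num)] at hs1
    exact (hV1 s (lt_of_le_of_ne hs1.2 hs)).symm
  have c2 : ∀ᵐ s ∂(volume : Measure ℝ), s ∈ Set.uIoc (1/2:ℝ) 1 →
      2 * v' (2 * s - 1) = Real.sqrt (A s ^ 2 + B s ^ 2) := by
    filter_upwards [hne] with s hs hs1
    rw [Set.uIoc_of_le (by norm_num)] at hs1
    exact (hV2 s (not_lt.2 hs1.1.le)).symm
  have j1 : IntervalIntegrable (fun s => Real.sqrt (A s ^ 2 + B s ^ 2)) volume 0 (1/2) := by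
    refine i1.congr_ae ?_
    exact (ae_restrict_iff' measurableSet_uIoc).2 c1
  have j2 : IntervalIntegrable (fun s => Real.sqrt (A s ^ 2 + B s ^ 2)) volume (1/2) 1 := by
    refine i2.congr_ae ?_
    exact (ae_restrict_iff' measurableSet_uIoc).2 c2
  refine ⟨fun s => γ (min (2 * s) 1) + γ' (max (2 * s - 1) 0) - Q, A, B,
    K * 2 + K' * 2 + 0, ?_, ?_, ?_, ?_, j1.trans j2, ?_⟩
  · have l2 : LipschitzWith 2 (fun s : ℝ => 2 * s) := by
      apply LipschitzWith.of_dist_le_mul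
      intro x y
      simp [Real.dist_eq, ← mul_sub, abs_mul]
    have l3 : LipschitzWith 2 (fun s : ℝ => 2 * s - 1) := by
      apply LipschitzWith.of_dist_le_mul
      intro x y
      simp [Real.dist_eq, ← mul_sub, abs_mul]
    exact ((hK.comp (l2.min_const 1)).add (hK'.comp (l3.max_const 0))).sub
      (LipschitzWith.const Q)
  · simp [h0, h0']
  · norm_num [h1, h1']
  · filter_upwards [ae_comp_affine hd 0, ae_comp_affine hd' 1, hne] with s hs1 hs2 hs3 hs4
    rcases lt_or_gt_of_ne hs3 with hs | hs
    · have ev : (fun s => γ (min (2 * s) 1) + γ' (max (2 * s - 1) 0) - Q) =ᶠ[nhds s]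
          fun s => γ (2 * s) := by
        filter_upwards [Iio_mem_nhds hs] with u hu
        have hu : u < 1/2 := hu
        rw [min_eq_left (by linarith), max_eq_right (by linarith), h0']; simp
      refine HasDerivAt.congr_of_eventuallyEq ?_ ev
      rw [ev.eq_of_nhds]
      have h5 := hs1 ⟨by linarith [hs4.1], by linarith⟩
      rw [sub_zero] at h5
      have h6 := HasDerivAt.scomp s h5 ((hasDerivAt_id s).const_mul 2)
      refine HasDerivAt.congr_deriv h6 ?_
      have eA : A s = 2 * a (2 * s) := if_pos hs
      have eB : B s = 2 * b (2 * s) := if_pos hs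
      rw [eA, eB]
      ext <;> simp
      ring
    · have ev : (fun s => γ (min (2 * s) 1) + γ' (max (2 * s - 1) 0) - Q) =ᶠ[nhds s]
          fun s => γ' (2 * s - 1) := by
        filter_upwards [Ioi_mem_nhds hs] with u hu
        have hu : 1/2 < u := hu
        rw [min_eq_right (by linarith), max_eq_left (by linarith), h1]; simp
      refine HasDerivAt.congr_of_eventuallyEq ?_ ev
      rw [ev.eq_of_nhds]
      have h5 := hs2 ⟨by linarith [hs4.1], by linarith [hs4.2]⟩
      have h6 := HasDerivAt.scomp s h5 (((hasDerivAt_id s).const_mul 2).sub_const 1)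
      refine HasDerivAt.congr_deriv h6 ?_
      have hs' : ¬ s < 1/2 := not_lt.2 hs.le
      have eA : A s = 2 * a' (2 * s - 1) := if_neg hs'
      have eB : B s = 2 * b' (2 * s - 1) := if_neg hs'
      rw [eA, eB]
      ext <;> simp
      ring
  · rw [← intervalIntegral.integral_add_adjacent_intervals j1 j2,
      ← intervalIntegral.integral_congr_ae c1, ← intervalIntegral.integral_congr_ae c2]
    rw [intervalIntegral.integral_const_mul, intervalIntegral.integral_const_mul,
      intervalIntegral.integral_comp_mul_left _ two_ne_zero,
      intervalIntegral.integral_comp_mul_sub _ two_ne_zero]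
    norm_num [hL, hL']
    ring


theorem ftc_lip {φ g : ℝ → ℝ} {K : NNReal} (hK : LipschitzWith K φ)
    (hd : ∀ᵐ s ∂(volume : Measure ℝ), s ∈ Set.Icc (0:ℝ) 1 → HasDerivAt φ (g s) s)
    {s : ℝ} (hs : s ∈ Set.Icc (0:ℝ) 1) :
    IntervalIntegrable g volume 0 s ∧ ∫ u in (0:ℝ)..s, g u = φ s - φ 0 := by
  have hac : AbsolutelyContinuousOnInterval φ 0 s :=
    (hK.lipschitzOnWith (s := Set.uIcc 0 s)).absolutelyContinuousOnInterval
  have c : ∀ᵐ u ∂(volume : Measure ℝ), u ∈ Set.uIoc (0:ℝ) s → deriv φ u = g u := by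
    filter_upwards [hd] with u hu hu1
    rw [Set.uIoc_of_le hs.1] at hu1
    exact (hu ⟨hu1.1.le, hu1.2.trans hs.2⟩).deriv
  constructor
  · exact hac.intervalIntegrable_deriv.congr_ae ((ae_restrict_iff' measurableSet_uIoc).2 c)
  · rw [← hac.integral_deriv_eq_sub, intervalIntegral.integral_congr_ae c]

theorem bound_lip {φ g G : ℝ → ℝ} {K : NNReal} (hK : LipschitzWith K φ)
    (hd : ∀ᵐ s ∂(volume : Measure ℝ), s ∈ Set.Icc (0:ℝ) 1 → HasDerivAt φ (g s) s)
    (hG : IntervalIntegrable G volume 0 1)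
    (hgG : ∀ᵐ s ∂(volume : Measure ℝ), s ∈ Set.Icc (0:ℝ) 1 → |g s| ≤ G s)
    {s : ℝ} (hs : s ∈ Set.Icc (0:ℝ) 1) : |φ s - φ 0| ≤ ∫ u in (0:ℝ)..1, G u := by
  obtain ⟨h1, h2⟩ := ftc_lip hK hd hs
  have hGs : IntervalIntegrable G volume 0 s := hG.mono_set (by
    rw [Set.uIcc_of_le hs.1, Set.uIcc_of_le zero_le_one]
    exact Set.Icc_subset_Icc_right hs.2)
  have hGs' : IntervalIntegrable G volume s 1 := hG.mono_set (by
    rw [Set.uIcc_of_le hs.2, Set.uIcc_of_le zero_le_one]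
    exact Set.Icc_subset_Icc_left hs.1)
  have hm : ∀ᵐ u ∂(volume : Measure ℝ), u ∈ Set.Icc s 1 → 0 ≤ G u := by
    filter_upwards [hgG] with u hu hu1
    exact (abs_nonneg _).trans (hu ⟨hs.1.trans hu1.1, hu1.2⟩)
  have h3 : 0 ≤ ∫ u in s..1, G u := by
    apply intervalIntegral.integral_nonneg_of_ae_restrict hs.2
    exact (ae_restrict_iff' measurableSet_Icc).2 hm
  rw [← h2, ← intervalIntegral.integral_add_adjacent_intervals hGs hGs']
  have h4 : |∫ u in (0:ℝ)..s, g u| ≤ ∫ u in (0:ℝ)..s, G u := by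
    have := intervalIntegral.norm_integral_le_of_norm_le (μ := volume) (f := g) (g := G) hs.1 (by
      filter_upwards [hgG] with u hu hu1
      exact hu ⟨hu1.1.le, hu1.2.trans hs.2⟩) hGs
    exact this
  linarith

theorem HC_lower {x y t L e₁ e₂ κ : ℝ} (h : HC HO (x, y, t) L) (he : e₁ ^ 2 + e₂ ^ 2 = 1)
    (hκ : 0 < κ) :
    e₁ * x + e₂ * y ≤ L ∧ |t| ≤ 2 * L * (κ * (L - (e₁ * x + e₂ * y)) + κ⁻¹ * (2 * L)) := by
  obtain ⟨γ, a, b, K, hK, h0, h1, hd, hi, hL⟩ := h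
  set v : ℝ → ℝ := fun s => Real.sqrt (a s ^ 2 + b s ^ 2) with hv
  have hv0 : ∀ s, 0 ≤ v s := fun s => Real.sqrt_nonneg _
  have hvsq : ∀ s, v s ^ 2 = a s ^ 2 + b s ^ 2 := fun s => Real.sq_sqrt (by positivity)
  -- components
  have lx : LipschitzWith K (fun s => (γ s).1) := by
    have := LipschitzWith.prod_fst.comp hK
    rwa [one_mul] at this
  have ly : LipschitzWith K (fun s => (γ s).2.1) := by
    have := LipschitzWith.prod_fst.comp (LipschitzWith.prod_snd.comp hK)
    rwa [one_mul, one_mul] at this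
  have lt : LipschitzWith K (fun s => (γ s).2.2) := by
    have := LipschitzWith.prod_snd.comp (LipschitzWith.prod_snd.comp hK)
    rwa [one_mul, one_mul] at this
  let pr1 : H →L[ℝ] ℝ := ContinuousLinearMap.fst ℝ ℝ (ℝ × ℝ)
  let pr2 : H →L[ℝ] ℝ := (ContinuousLinearMap.fst ℝ ℝ ℝ).comp (ContinuousLinearMap.snd ℝ ℝ (ℝ × ℝ))
  let pr3 : H →L[ℝ] ℝ := (ContinuousLinearMap.snd ℝ ℝ ℝ).comp (ContinuousLinearMap.snd ℝ ℝ (ℝ × ℝ))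
  have dx : ∀ᵐ s ∂(volume : Measure ℝ), s ∈ Set.Icc (0:ℝ) 1 →
      HasDerivAt (fun s => (γ s).1) (a s) s := by
    filter_upwards [hd] with s hs hs1
    exact pr1.hasFDerivAt.comp_hasDerivAt s (hs hs1)
  have dy : ∀ᵐ s ∂(volume : Measure ℝ), s ∈ Set.Icc (0:ℝ) 1 →
      HasDerivAt (fun s => (γ s).2.1) (b s) s := by
    filter_upwards [hd] with s hs hs1
    exact pr2.hasFDerivAt.comp_hasDerivAt s (hs hs1)
  have dt : ∀ᵐ s ∂(volume : Measure ℝ), s ∈ Set.Icc (0:ℝ) 1 →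
      HasDerivAt (fun s => (γ s).2.2) (2 * (γ s).2.1 * a s - 2 * (γ s).1 * b s) s := by
    filter_upwards [hd] with s hs hs1
    exact pr3.hasFDerivAt.comp_hasDerivAt s (hs hs1)
  have one : (1:ℝ) ∈ Set.Icc (0:ℝ) 1 := ⟨zero_le_one, le_rfl⟩
  obtain ⟨ia, ea⟩ := ftc_lip lx dx one
  obtain ⟨ib, eb⟩ := ftc_lip ly dy one
  have ex : ∫ u in (0:ℝ)..1, a u = x := by rw [ea, h0, h1]; simp [HO]
  have ey : ∫ u in (0:ℝ)..1, b u = y := by rw [eb, h0, h1]; simp [HO]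
  set c := e₁ * x + e₂ * y with hc
  let ξ' : ℝ → ℝ := fun s => e₁ * a s + e₂ * b s
  let ζ' : ℝ → ℝ := fun s => - e₂ * a s + e₁ * b s
  have iξ : IntervalIntegrable ξ' volume 0 1 := (ia.const_mul e₁).add (ib.const_mul e₂)
  have eξ : ∫ u in (0:ℝ)..1, ξ' u = c := by
    simp only [ξ']
    rw [intervalIntegral.integral_add (ia.const_mul e₁) (ib.const_mul e₂),
      intervalIntegral.integral_const_mul, intervalIntegral.integral_const_mul, ex, ey]
  have sq : ∀ s, ξ' s ^ 2 + ζ' s ^ 2 = v s ^ 2 := by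
    intro s
    rw [hvsq]
    simp only [ξ', ζ']
    linear_combination (a s ^ 2 + b s ^ 2) * he
  have bξ : ∀ s, |ξ' s| ≤ v s := fun s =>
    abs_le_of_sq_le_sq (by nlinarith [sq s, sq_nonneg (ζ' s)]) (hv0 s)
  have hcL : c ≤ L := by
    rw [← eξ, hL]
    exact intervalIntegral.integral_mono_on zero_le_one iξ hi
      (fun s _ => (le_abs_self _).trans (bξ s))
  refine ⟨hcL, ?_⟩
  let g : ℝ → ℝ := fun s => (κ * (v s - ξ' s) + κ⁻¹ * (v s + ξ' s)) / 2
  have hκi : 0 < κ⁻¹ := inv_pos.2 hκ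
  have hg0 : ∀ s, 0 ≤ g s := by
    intro s
    have := abs_le.1 (bξ s)
    have h1 : 0 ≤ κ * (v s - ξ' s) := mul_nonneg hκ.le (by linarith)
    have h2 : 0 ≤ κ⁻¹ * (v s + ξ' s) := mul_nonneg hκi.le (by linarith)
    simp only [g]; linarith
  have bζ : ∀ s, |ζ' s| ≤ g s := by
    intro s
    apply abs_le_of_sq_le_sq _ (hg0 s)
    have h1 : ζ' s ^ 2 = (v s - ξ' s) * (v s + ξ' s) := by linarith [sq s]
    have h2 : κ * κ⁻¹ = 1 := mul_inv_cancel₀ hκ.ne'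
    have h3 : g s ^ 2 - ζ' s ^ 2 = ((κ * (v s - ξ' s) - κ⁻¹ * (v s + ξ' s)) / 2) ^ 2 := by
      rw [h1]; simp only [g]
      linear_combination (v s - ξ' s) * (v s + ξ' s) * h2
    nlinarith [sq_nonneg ((κ * (v s - ξ' s) - κ⁻¹ * (v s + ξ' s)) / 2)]
  have ig : IntervalIntegrable g volume 0 1 :=
    (((hi.sub iξ).const_mul κ).add ((hi.add iξ).const_mul κ⁻¹)).div_const 2
  have eg : ∫ u in (0:ℝ)..1, g u = (κ * (L - c) + κ⁻¹ * (L + c)) / 2 := by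
    simp only [g]
    rw [intervalIntegral.integral_div,
      intervalIntegral.integral_add ((hi.sub iξ).const_mul κ) ((hi.add iξ).const_mul κ⁻¹),
      intervalIntegral.integral_const_mul, intervalIntegral.integral_const_mul,
      intervalIntegral.integral_sub hi iξ, intervalIntegral.integral_add hi iξ, eξ, hL]
  set h := (κ * (L - c) + κ⁻¹ * (L + c)) / 2 with hh
  have hL0 : 0 ≤ L := by
    rw [hL]; exact intervalIntegral.integral_nonneg zero_le_one (fun s _ => hv0 s)
  have hh0 : 0 ≤ h := by
    rw [← eg]; exact intervalIntegral.integral_nonneg zero_le_one (fun s _ => hg0 s)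
  have Bξ : ∀ s ∈ Set.Icc (0:ℝ) 1, |e₁ * (γ s).1 + e₂ * (γ s).2.1| ≤ L := by
    intro s hs
    have hlip : LipschitzWith _ (fun s => e₁ * (γ s).1 + e₂ * (γ s).2.1) :=
      ((lipschitzWith_smul e₁).comp lx).add ((lipschitzWith_smul e₂).comp ly)
    have := bound_lip (g := ξ') hlip (by
      filter_upwards [dx, dy] with s h1 h2 h3
      exact ((h1 h3).const_mul e₁).add ((h2 h3).const_mul e₂)) hi
      (Filter.Eventually.of_forall fun s _ => bξ s) hs
    simpa [h0, HO, hL] using this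
  have Bζ : ∀ s ∈ Set.Icc (0:ℝ) 1, |- e₂ * (γ s).1 + e₁ * (γ s).2.1| ≤ h := by
    intro s hs
    have hlip : LipschitzWith _ (fun s => - e₂ * (γ s).1 + e₁ * (γ s).2.1) :=
      ((lipschitzWith_smul (- e₂)).comp lx).add ((lipschitzWith_smul e₁).comp ly)
    have := bound_lip (g := ζ') hlip (by
      filter_upwards [dx, dy] with s h1 h2 h3
      exact ((h1 h3).const_mul (- e₂)).add ((h2 h3).const_mul e₁)) ig
      (Filter.Eventually.of_forall fun s _ => bζ s) hs
    simpa [h0, HO, eg] using this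
  have Bt : |t| ≤ ∫ u in (0:ℝ)..1, (2 * h * v u + 2 * L * g u) := by
    have := bound_lip (G := fun u => 2 * h * v u + 2 * L * g u) lt dt
      ((hi.const_mul (2 * h)).add (ig.const_mul (2 * L)))
      (Filter.Eventually.of_forall fun s hs => by
        have e : 2 * (γ s).2.1 * a s - 2 * (γ s).1 * b s =
          2 * ((- e₂ * (γ s).1 + e₁ * (γ s).2.1) * ξ' s - (e₁ * (γ s).1 + e₂ * (γ s).2.1) * ζ' s) := by
          simp only [ξ', ζ']
          linear_combination (- (2 * (γ s).2.1 * a s - 2 * (γ s).1 * b s)) * he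
        rw [e, abs_mul, abs_two]
        have p1 := mul_le_mul (Bζ s hs) (bξ s) (abs_nonneg _) hh0
        have p2 := mul_le_mul (Bξ s hs) (bζ s) (abs_nonneg _) hL0
        have p3 := abs_sub ((- e₂ * (γ s).1 + e₁ * (γ s).2.1) * ξ' s)
          ((e₁ * (γ s).1 + e₂ * (γ s).2.1) * ζ' s)
        rw [abs_mul, abs_mul] at p3
        linarith) one
    simpa [h0, h1, HO] using this
  rw [intervalIntegral.integral_add (hi.const_mul _) (ig.const_mul _),
    intervalIntegral.integral_const_mul, intervalIntegral.integral_const_mul, eg, ← hL] at Bt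
  have h5 : κ⁻¹ * (L + c) ≤ κ⁻¹ * (2 * L) := mul_le_mul_of_nonneg_left (by linarith) hκi.le
  calc |t| ≤ 2 * L * (2 * h) := by linarith
    _ ≤ _ := by
      apply mul_le_mul_of_nonneg_left _ (by linarith)
      rw [hh]; linarith


def nH (p : H) : ℝ := dH HO p

theorem Hmul_assoc (p q r : H) : Hmul (Hmul p q) r = Hmul p (Hmul q r) := by
  ext <;> simp [Hmul] <;> ring

theorem Hinv_mul_cancel (p q : H) : Hmul (Hinv p) (Hmul p q) = q := by
  ext <;> simp [Hmul, Hinv]; ring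

theorem Hmul_inv_cancel (p q : H) : Hmul p (Hmul (Hinv p) q) = q := by
  ext <;> simp [Hmul, Hinv]; ring

theorem Hmul_HO (p : H) : Hmul p HO = p := by
  ext <;> simp [Hmul, HO]

theorem HO_Hmul (p : H) : Hmul HO p = p := by
  ext <;> simp [Hmul, HO]

theorem Hinv_Hmul_self (p : H) : Hmul (Hinv p) p = HO := by
  ext <;> simp [Hmul, Hinv, HO]

theorem HC_mul {p q : H} {L L' : ℝ} (h : HC HO p L) (h' : HC HO q L') :
    HC HO (Hmul p q) (L + L') := by
  have := HC_translate p h'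
  rw [Hmul_HO] at this
  exact HC_concat h this

theorem HC_comm (x y : ℝ) : ∃ L, L ≤ 2 * |x| + 2 * |y| ∧ HC HO (0, 0, -4 * (x * y)) L := by
  have h1 := HC_seg x 0
  have h2 := HC_seg 0 y
  have h3 := HC_seg (-x) 0
  have h4 := HC_seg 0 (-y)
  have h5 := HC_mul h1 (HC_mul h2 (HC_mul h3 h4))
  have h6 : Hmul (x, 0, 0) (Hmul (0, y, 0) (Hmul (-x, 0, 0) (0, -y, 0))) = (0, 0, -4 * (x * y)) := by
    ext <;> simp [Hmul]; ring
  rw [h6] at h5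
  refine ⟨_, ?_, h5⟩
  · have e : ∀ u : ℝ, Real.sqrt (u ^ 2 + 0 ^ 2) = |u| := fun u => by
      rw [show u ^ 2 + 0 ^ 2 = u ^ 2 by ring, Real.sqrt_sq_eq_abs]
    have e' : ∀ u : ℝ, Real.sqrt (0 ^ 2 + u ^ 2) = |u| := fun u => by
      rw [show 0 ^ 2 + u ^ 2 = u ^ 2 by ring, Real.sqrt_sq_eq_abs]
    rw [e, e', e, e', abs_neg, abs_neg]; linarith

theorem HC_vert (t : ℝ) : ∃ L, L ≤ 2 * Real.sqrt |t| ∧ HC HO (0, 0, t) L := by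
  have hs : Real.sqrt |t| * Real.sqrt |t| = |t| := Real.mul_self_sqrt (abs_nonneg t)
  have h0 := Real.sqrt_nonneg |t|
  rcases le_total 0 t with ht | ht
  · obtain ⟨L, h1, h2⟩ := HC_comm (-(Real.sqrt |t|) / 2) (Real.sqrt |t| / 2)
    refine ⟨L, ?_, ?_⟩
    · rw [abs_div, abs_div, abs_neg, abs_of_nonneg h0, abs_two] at h1; linarith
    · convert h2 using 3
      rw [abs_of_nonneg ht] at hs ⊢
      linarith
  · obtain ⟨L, h1, h2⟩ := HC_comm ((Real.sqrt |t|) / 2) (Real.sqrt |t| / 2)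
    refine ⟨L, ?_, ?_⟩
    · rw [abs_div, abs_of_nonneg h0, abs_two] at h1; linarith
    · convert h2 using 3
      rw [abs_of_nonpos ht] at hs ⊢
      linarith

theorem HC_exists (p : H) : ∃ L, HC HO p L := by
  obtain ⟨L, _, h⟩ := HC_vert p.2.2
  have := HC_mul (HC_seg p.1 p.2.1) h
  have e : Hmul (p.1, p.2.1, 0) (0, 0, p.2.2) = p := by ext <;> simp [Hmul]
  rw [e] at this
  exact ⟨_, this⟩

theorem HC_nonneg {P Q : H} {L : ℝ} (h : HC P Q L) : 0 ≤ L := by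
  obtain ⟨γ, a, b, K, hK, h0, h1, hd, hi, hL⟩ := h
  rw [hL]
  exact intervalIntegral.integral_nonneg zero_le_one (fun s _ => Real.sqrt_nonneg _)

theorem HC_bdd (P Q : H) : BddBelow {L | HC P Q L} := ⟨0, fun _ h => HC_nonneg h⟩

theorem nH_le {p : H} {L : ℝ} (h : HC HO p L) : nH p ≤ L := csInf_le (HC_bdd _ _) h

theorem nH_nonneg (p : H) : 0 ≤ nH p := Real.sInf_nonneg (fun _ h => HC_nonneg h)

theorem nH_lt {p : H} {δ : ℝ} (hδ : 0 < δ) : ∃ L, HC HO p L ∧ L < nH p + δ :=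
  Real.lt_sInf_add_pos (s := {L | HC HO p L}) (HC_exists p) hδ

theorem dH_nH (P Q : H) : dH P Q = nH (Hmul (Hinv P) Q) := by
  unfold nH
  rw [dH_eq, dH_eq]
  congr 1
  ext L
  constructor
  · intro h
    have := HC_translate (Hinv P) h
    rwa [Hinv_Hmul_self] at this
  · intro h
    have := HC_translate P h
    rwa [Hmul_HO, Hmul_inv_cancel] at this

theorem nH_mul (p q : H) : nH (Hmul p q) ≤ nH p + nH q := by
  apply le_of_forall_pos_le_add
  intro δ hδ
  obtain ⟨L, h1, h2⟩ := nH_lt (p := p) (half_pos hδ)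
  obtain ⟨L', h1', h2'⟩ := nH_lt (p := q) (half_pos hδ)
  linarith [nH_le (HC_mul h1 h1')]

theorem nH_seg (x y : ℝ) : nH (x, y, 0) ≤ Real.sqrt (x ^ 2 + y ^ 2) := nH_le (HC_seg x y)

theorem nH_vert (t : ℝ) : nH (0, 0, t) ≤ 2 * Real.sqrt |t| := by
  obtain ⟨L, h1, h2⟩ := HC_vert t
  exact (nH_le h2).trans h1

theorem Hdil_HO (r : ℝ) : Hdil r HO = HO := by ext <;> simp [Hdil, HO]

theorem Hdil_mul (r : ℝ) (p q : H) : Hdil r (Hmul p q) = Hmul (Hdil r p) (Hdil r q) := by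
  ext <;> simp [Hdil, Hmul] <;> ring

theorem Hdil_inv (r : ℝ) (p : H) : Hdil r (Hinv p) = Hinv (Hdil r p) := by
  ext <;> simp [Hdil, Hinv]

theorem nH_dil_le (r : ℝ) (hr : 0 ≤ r) (p : H) : nH (Hdil r p) ≤ r * nH p := by
  apply le_of_forall_pos_le_add
  intro δ hδ
  obtain ⟨L, h1, h2⟩ := nH_lt (p := p) (show 0 < δ / (r + 1) by positivity)
  have h3 := HC_dil r hr h1
  rw [Hdil_HO] at h3
  have h4 := nH_le h3
  have h5 : r * L ≤ r * (nH p + δ / (r + 1)) := mul_le_mul_of_nonneg_left h2.le hr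
  have h6 : r * (δ / (r + 1)) ≤ δ := by
    rw [mul_div_assoc', div_le_iff₀ (by linarith)]; nlinarith
  linarith

theorem nH_dil (r : ℝ) (hr : 0 < r) (p : H) : nH (Hdil r p) = r * nH p := by
  apply le_antisymm (nH_dil_le r hr.le p)
  have h := nH_dil_le r⁻¹ (inv_pos.2 hr).le (Hdil r p)
  have e : Hdil r⁻¹ (Hdil r p) = p := by
    ext <;> simp [Hdil] <;> field_simp
  rw [e] at h
  calc r * nH p ≤ r * (r⁻¹ * nH (Hdil r p)) := mul_le_mul_of_nonneg_left h hr.le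
    _ = _ := by field_simp

theorem nH_lower (p : H) {e₁ e₂ κ : ℝ} (he : e₁ ^ 2 + e₂ ^ 2 = 1) (hκ : 0 < κ) :
    e₁ * p.1 + e₂ * p.2.1 ≤ nH p ∧
    |p.2.2| ≤ 2 * nH p * (κ * (nH p - (e₁ * p.1 + e₂ * p.2.1)) + κ⁻¹ * (2 * nH p)) := by
  have key : ∀ L, HC HO p L → e₁ * p.1 + e₂ * p.2.1 ≤ L ∧
    |p.2.2| ≤ 2 * L * (κ * (L - (e₁ * p.1 + e₂ * p.2.1)) + κ⁻¹ * (2 * L)) :=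
    fun L h => HC_lower h he hκ
  constructor
  · apply le_of_forall_pos_le_add
    intro δ hδ
    obtain ⟨L, h1, h2⟩ := nH_lt (p := p) hδ
    linarith [(key L h1).1]
  · obtain ⟨u, _, hu, hmem⟩ := exists_seq_tendsto_sInf (S := {L | HC HO p L}) (HC_exists p)
      (HC_bdd _ _)
    have hu' : Filter.Tendsto u Filter.atTop (nhds (nH p)) := hu
    have hcont : Continuous (fun L : ℝ =>
      2 * L * (κ * (L - (e₁ * p.1 + e₂ * p.2.1)) + κ⁻¹ * (2 * L))) := by fun_prop
    exact ge_of_tendsto ((hcont.tendsto _).comp hu')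
      (Filter.Eventually.of_forall fun n => (key _ (hmem n)).2)

theorem exists_dir (x y : ℝ) : ∃ e₁ e₂ : ℝ, e₁ ^ 2 + e₂ ^ 2 = 1 ∧
    e₁ * x + e₂ * y = Real.sqrt (x ^ 2 + y ^ 2) := by
  rcases eq_or_ne (Real.sqrt (x ^ 2 + y ^ 2)) 0 with h | h
  · have h2 : x ^ 2 + y ^ 2 = 0 := by
      have := Real.sq_sqrt (show 0 ≤ x ^ 2 + y ^ 2 by positivity)
      rw [h] at this; linarith
    have hx : x = 0 := by nlinarith [sq_nonneg x, sq_nonneg y]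
    refine ⟨1, 0, by norm_num, ?_⟩
    rw [h, hx]; simp
  · have h2 := Real.sq_sqrt (show 0 ≤ x ^ 2 + y ^ 2 by positivity)
    refine ⟨x / Real.sqrt (x ^ 2 + y ^ 2), y / Real.sqrt (x ^ 2 + y ^ 2), ?_, ?_⟩
    · rw [div_pow, div_pow, ← add_div, h2]
      apply div_self
      rw [← h2]; exact pow_ne_zero 2 h
    · rw [div_mul_eq_mul_div, div_mul_eq_mul_div, ← add_div, div_eq_iff h]
      nlinarith

theorem nH_t (p : H) {κ : ℝ} (hκ : 0 < κ) :
    |p.2.2| ≤ 2 * nH p * (κ * (nH p - Real.sqrt (p.1 ^ 2 + p.2.1 ^ 2)) + κ⁻¹ * (2 * nH p)) := by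
  obtain ⟨e₁, e₂, h1, h2⟩ := exists_dir p.1 p.2.1
  have := (nH_lower p h1 hκ).2
  rwa [h2] at this

theorem nH_z (p : H) : Real.sqrt (p.1 ^ 2 + p.2.1 ^ 2) ≤ nH p := by
  obtain ⟨e₁, e₂, h1, h2⟩ := exists_dir p.1 p.2.1
  have := (nH_lower p h1 one_pos).1
  rwa [h2] at this

theorem nH_zsq (p : H) : p.1 ^ 2 + p.2.1 ^ 2 ≤ nH p ^ 2 :=
  (Real.sqrt_le_left (nH_nonneg p)).1 (nH_z p)

theorem nH_t6 (p : H) : |p.2.2| ≤ 6 * nH p ^ 2 := by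
  have := nH_t p one_pos
  have h2 := Real.sqrt_nonneg (p.1 ^ 2 + p.2.1 ^ 2)
  have h3 := nH_nonneg p
  rw [inv_one] at this
  nlinarith [mul_nonneg h2 h3]

theorem nH_seg_eq (x y : ℝ) : nH (x, y, 0) = Real.sqrt (x ^ 2 + y ^ 2) :=
  le_antisymm (nH_seg x y) (nH_z (x, y, 0))

theorem nH_upper (x y t : ℝ) :
    nH (x, y, t) ≤ Real.sqrt (x ^ 2 + y ^ 2) + 2 * Real.sqrt |t| := by
  have h := nH_mul (x, y, 0) (0, 0, t)
  have e : Hmul (x, y, 0) (0, 0, t) = (x, y, t) := by ext <;> simp [Hmul]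
  rw [e] at h
  linarith [nH_seg x y, nH_vert t]

theorem nH_conj (q₁ q₂ t τ r : ℝ) (hr : 0 < r) (hq : q₁ ^ 2 + q₂ ^ 2 = r ^ 2) :
    nH (q₁, q₂, t + τ) ≤ nH (q₁, q₂, t) + |τ| / (2 * r) := by
  set l := τ / (4 * r ^ 2) with hl
  have e : Hmul (-l * q₂, l * q₁, 0) (Hmul (q₁, q₂, t) (l * q₂, -l * q₁, 0)) = (q₁, q₂, t + τ) := by
    have : τ = l * (4 * (q₁ ^ 2 + q₂ ^ 2)) := by rw [hq, hl]; field_simp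
    rw [this]
    ext <;> simp [Hmul]; ring
  have h1 := nH_mul (-l * q₂, l * q₁, 0) (Hmul (q₁, q₂, t) (l * q₂, -l * q₁, 0))
  have h2 := nH_mul (q₁, q₂, t) (l * q₂, -l * q₁, 0)
  have h3 := nH_seg (-l * q₂) (l * q₁)
  have h4 := nH_seg (l * q₂) (-l * q₁)
  rw [e] at h1
  have e3 : Real.sqrt ((-l * q₂) ^ 2 + (l * q₁) ^ 2) = |l| * r := by
    rw [show (-l * q₂) ^ 2 + (l * q₁) ^ 2 = (l * r) ^ 2 by rw [mul_pow l r, ← hq]; ring,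
      Real.sqrt_sq_eq_abs, abs_mul, abs_of_pos hr]
  have e4 : Real.sqrt ((l * q₂) ^ 2 + (-l * q₁) ^ 2) = |l| * r := by
    rw [show (l * q₂) ^ 2 + (-l * q₁) ^ 2 = (l * r) ^ 2 by rw [mul_pow l r, ← hq]; ring,
      Real.sqrt_sq_eq_abs, abs_mul, abs_of_pos hr]
  rw [e3] at h3
  rw [e4] at h4
  have e5 : |l| * r + |l| * r = |τ| / (2 * r) := by
    rw [hl, abs_div, abs_of_pos (show 0 < 4 * r ^ 2 by positivity)]
    field_simp; ring
  linarith


structure Good (ε : ℝ) (f : H → H) : Prop where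
  lo : ∀ P Q : H, (1 + ε)⁻¹ * nH (Hmul (Hinv P) Q) ≤ nH (Hmul (Hinv (f P)) (f Q))
  hi : ∀ P Q : H, nH (Hmul (Hinv (f P)) (f Q)) ≤ (1 + ε) * nH (Hmul (Hinv P) Q)
  zero : f HO = HO

theorem Hinv_HO : Hinv HO = HO := by ext <;> simp [Hinv, HO]

theorem Good.lo0 {ε : ℝ} {f : H → H} (hf : Good ε f) (Q : H) :
    (1 + ε)⁻¹ * nH Q ≤ nH (f Q) := by
  have := hf.lo HO Q
  rwa [hf.zero, Hinv_HO, HO_Hmul, HO_Hmul] at this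

theorem Good.hi0 {ε : ℝ} {f : H → H} (hf : Good ε f) (Q : H) :
    nH (f Q) ≤ (1 + ε) * nH Q := by
  have := hf.hi HO Q
  rwa [hf.zero, Hinv_HO, HO_Hmul, HO_Hmul] at this

def trf (f : H → H) (P : H) : H → H := fun p => Hmul (Hinv (f P)) (f (Hmul P p))

def dlf (f : H → H) (r : ℝ) : H → H := fun p => Hdil r⁻¹ (f (Hdil r p))

theorem quot_translate (p a b : H) :
    Hmul (Hinv (Hmul p a)) (Hmul p b) = Hmul (Hinv a) b := by
  ext <;> simp [Hmul, Hinv]; ring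

theorem Good.trf {ε : ℝ} {f : H → H} (hf : Good ε f) (P : H) : Good ε (trf f P) := by
  refine ⟨?_, ?_, ?_⟩
  · intro p q
    have := hf.lo (Hmul P p) (Hmul P q)
    rw [quot_translate] at this
    simpa only [_root_.trf, quot_translate] using this
  · intro p q
    have := hf.hi (Hmul P p) (Hmul P q)
    rw [quot_translate] at this
    simpa only [_root_.trf, quot_translate] using this
  · simp only [_root_.trf, Hmul_HO, Hinv_Hmul_self]

theorem Good.dlf {ε : ℝ} {f : H → H} (hf : Good ε f) {r : ℝ} (hr : 0 < r) :
    Good ε (dlf f r) := by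
  have hri := inv_pos.2 hr
  have e : ∀ x, r⁻¹ * (r * x) = x := fun x => by field_simp
  refine ⟨?_, ?_, ?_⟩
  · intro p q
    have := hf.lo (Hdil r p) (Hdil r q)
    rw [← Hdil_inv, ← Hdil_mul, nH_dil r hr] at this
    simp only [_root_.dlf]
    rw [← Hdil_inv, ← Hdil_mul, nH_dil _ hri]
    have := mul_le_mul_of_nonneg_left this hri.le
    rwa [mul_left_comm, e] at this
  · intro p q
    have := hf.hi (Hdil r p) (Hdil r q)
    rw [← Hdil_inv, ← Hdil_mul, nH_dil r hr] at this
    simp only [_root_.dlf]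
    rw [← Hdil_inv, ← Hdil_mul, nH_dil _ hri]
    have := mul_le_mul_of_nonneg_left this hri.le
    rwa [mul_left_comm _ (1 + ε), e] at this
  · simp only [_root_.dlf, Hdil_HO, hf.zero]

theorem cs_bound {a b c d A B : ℝ} (hA : 0 ≤ A) (hB : 0 ≤ B) (h1 : a ^ 2 + b ^ 2 ≤ A ^ 2)
    (h2 : c ^ 2 + d ^ 2 ≤ B ^ 2) : |a * c + b * d| ≤ A * B := by
  apply abs_le_of_sq_le_sq _ (by positivity)
  have h3 : (a ^ 2 + b ^ 2) * (c ^ 2 + d ^ 2) ≤ A ^ 2 * B ^ 2 :=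
    mul_le_mul h1 h2 (by positivity) (by positivity)
  nlinarith [sq_nonneg (a * d - b * c)]

theorem om_bound {a b c d A B : ℝ} (hA : 0 ≤ A) (hB : 0 ≤ B) (h1 : a ^ 2 + b ^ 2 ≤ A ^ 2)
    (h2 : c ^ 2 + d ^ 2 ≤ B ^ 2) : |c * b - a * d| ≤ A * B := by
  have := cs_bound (a := a) (b := b) (c := -d) (d := c) hA hB h1 (by nlinarith)
  rwa [show a * -d + b * c = c * b - a * d by ring] at this

theorem long_chord {ε : ℝ} {f : H → H} (hf : Good ε f) (hε0 : 0 ≤ ε) (hε : ε ≤ 1/100)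
    {v₁ v₂ : ℝ} (hv : v₁ ^ 2 + v₂ ^ 2 = 1) :
    ∃ s ∈ Set.Icc (0:ℝ) 1,
      (3/100) ^ 2 ≤ (f (s * v₁, s * v₂, 0)).1 ^ 2 + (f (s * v₁, s * v₂, 0)).2.1 ^ 2 := by
  by_contra! hcon
  set g : ℕ → H := fun k => f ((k:ℝ) / 64 * v₁, (k:ℝ) / 64 * v₂, 0) with hg
  have key : ∀ k : ℕ, k ≤ 64 → |(g k).2.2| ≤ k * (1/400) := by
    intro k
    induction k with
    | zero =>
      intro _
      have : g 0 = HO := by simp only [hg]; rw [← hf.zero]; simp [HO]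
      rw [this]; simp [HO]
    | succ k ih =>
      intro hk
      have ih := ih (by omega)
      set D := Hmul (Hinv (g k)) (g (k + 1)) with hD
      have hn : nH D ≤ 0.016 := by
        have h1 := hf.hi ((k:ℝ) / 64 * v₁, (k:ℝ) / 64 * v₂, 0)
          (((k + 1 : ℕ):ℝ) / 64 * v₁, ((k + 1 : ℕ):ℝ) / 64 * v₂, 0)
        have e : Hmul (Hinv ((k:ℝ) / 64 * v₁, (k:ℝ) / 64 * v₂, 0))
          (((k + 1 : ℕ):ℝ) / 64 * v₁, ((k + 1 : ℕ):ℝ) / 64 * v₂, 0) = (v₁ / 64, v₂ / 64, 0) := by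
          ext <;> simp [Hmul, Hinv] <;> ring
        rw [e] at h1
        have h2 := nH_seg (v₁ / 64) (v₂ / 64)
        rw [show (v₁ / 64) ^ 2 + (v₂ / 64) ^ 2 = (1 / 64) ^ 2 by
          linear_combination (1 / 64) ^ 2 * hv, Real.sqrt_sq (by norm_num)] at h2
        have h3 : nH D ≤ (1 + ε) * nH (v₁ / 64, v₂ / 64, 0) := h1
        nlinarith [nH_nonneg (v₁ / 64, v₂ / 64, 0)]
      have hD0 := nH_nonneg D
      have ht := nH_t6 D
      have hz : D.1 ^ 2 + D.2.1 ^ 2 ≤ 0.016 ^ 2 := by nlinarith [nH_zsq D]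
      have hgk := hcon ((k:ℝ) / 64) ⟨by positivity, by
        rw [div_le_one (by norm_num)]; exact_mod_cast (by omega : k ≤ 64)⟩
      have hom := om_bound (a := (g k).1) (b := (g k).2.1) (c := D.1) (d := D.2.1)
        (A := 3/100) (B := 0.016) (by norm_num) (by norm_num) hgk.le hz
      have e : g (k + 1) = Hmul (g k) D := by rw [hD, Hmul_inv_cancel]
      have e2 : (g (k + 1)).2.2 = (g k).2.2 + D.2.2 + 2 * (D.1 * (g k).2.1 - (g k).1 * D.2.1) := by
        rw [e]; rfl
      have ht' : |D.2.2| ≤ 6 * 0.016 ^ 2 := by nlinarith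
      rw [e2]
      push_cast
      rw [abs_le] at *
      constructor <;> linarith [ih.1, ih.2, ht'.1, ht'.2, hom.1, hom.2]
  have h1 := key 64 le_rfl
  have e64 : g 64 = f (1 * v₁, 1 * v₂, 0) := by simp [hg]
  have h2 := hcon 1 ⟨zero_le_one, le_rfl⟩
  rw [← e64] at h2
  have h3 := nH_upper (g 64).1 (g 64).2.1 (g 64).2.2
  have h4 : Real.sqrt ((g 64).1 ^ 2 + (g 64).2.1 ^ 2) ≤ 3/100 := by
    rw [Real.sqrt_le_left (by norm_num)]; exact h2.le
  have h5 : Real.sqrt |(g 64).2.2| ≤ 0.4 := by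
    rw [Real.sqrt_le_left (by norm_num)]; norm_num at h1 ⊢; linarith
  have h6 := hf.lo0 (1 * v₁, 1 * v₂, 0)
  rw [← e64, nH_seg_eq, show (1 * v₁) ^ 2 + (1 * v₂) ^ 2 = 1 by linear_combination hv, Real.sqrt_one,
    mul_one] at h6
  have h7 : (100/101 : ℝ) ≤ (1 + ε)⁻¹ := by
    rw [le_inv_comm₀ (by norm_num) (by linarith)]; norm_num; linarith
  have h8 : nH (g 64) ≤ 3/100 + 2 * 0.4 := by
    have : nH (g 64) = nH ((g 64).1, (g 64).2.1, (g 64).2.2) := rfl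
    rw [this]; linarith
  norm_num at h8
  linarith

theorem lineA0 {ε h : ℝ} {f : H → H} (hf : Good ε f) (hε0 : 0 ≤ ε) (hh : 0 < h)
    (hh1 : h ≤ 1/1000) (hε : ε ≤ h ^ 4) {v₁ v₂ : ℝ} (hv : v₁ ^ 2 + v₂ ^ 2 = 1) :
    h ^ 2 - 120 * h ^ 4 ≤ Real.sqrt ((f (h ^ 2 * v₁, h ^ 2 * v₂, 0)).1 ^ 2
      + (f (h ^ 2 * v₁, h ^ 2 * v₂, 0)).2.1 ^ 2) := by
  have hh4 : h ^ 4 ≤ 1/100 := by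
    calc h ^ 4 ≤ (1/1000) ^ 4 := by gcongr
      _ ≤ _ := by norm_num
  have hh2 : h ^ 2 ≤ 1/100 := by
    calc h ^ 2 ≤ (1/1000) ^ 2 := by gcongr
      _ ≤ _ := by norm_num
  have hε1 : ε ≤ 1/100 := hε.trans hh4
  set P : H := (h ^ 2 * v₁, h ^ 2 * v₂, 0) with hP
  obtain ⟨s, hs, hlong⟩ := long_chord (hf.trf P) hε0 hε1 hv
  set S : H := (s * v₁, s * v₂, 0) with hS
  set q := trf f P S with hq
  have eq1 : f (Hmul P S) = Hmul (f P) q := by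
    rw [hq, trf, Hmul_inv_cancel]
  have eq2 : Hmul P S = ((h ^ 2 + s) * v₁, (h ^ 2 + s) * v₂, 0) := by
    ext <;> simp [Hmul, hP, hS] <;> ring
  have nS : nH S = s := by
    rw [hS, nH_seg_eq, show (s * v₁) ^ 2 + (s * v₂) ^ 2 = s ^ 2 by linear_combination s ^ 2 * hv,
      Real.sqrt_sq hs.1]
  have nP : nH P = h ^ 2 := by
    rw [hP, nH_seg_eq, show (h ^ 2 * v₁) ^ 2 + (h ^ 2 * v₂) ^ 2 = (h ^ 2) ^ 2 by
      linear_combination (h ^ 2) ^ 2 * hv, Real.sqrt_sq (by positivity)]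
  have nPS : nH (Hmul P S) = h ^ 2 + s := by
    have := hs.1
    rw [eq2, nH_seg_eq, show ((h ^ 2 + s) * v₁) ^ 2 + ((h ^ 2 + s) * v₂) ^ 2 = (h ^ 2 + s) ^ 2 by
      linear_combination (h ^ 2 + s) ^ 2 * hv, Real.sqrt_sq (by positivity)]
  have b1 := (hf.trf P).hi0 S
  rw [← hq, nS] at b1
  have b2 := hf.hi0 P
  rw [nP] at b2
  have b3 := hf.lo0 (Hmul P S)
  rw [nPS] at b3
  have b3' : (1 - ε) * (h ^ 2 + s) ≤ (1 + ε)⁻¹ * (h ^ 2 + s) := by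
    apply mul_le_mul_of_nonneg_right _ (by have := hs.1; positivity)
    rw [le_inv_comm₀ (by linarith) (by linarith), inv_eq_one_div, le_div_iff₀ (by linarith)]
    nlinarith
  set r := Real.sqrt (q.1 ^ 2 + q.2.1 ^ 2) with hr
  have hr3 : 3/100 ≤ r := Real.le_sqrt_of_sq_le hlong
  have hr0 : 0 < r := by linarith
  have c1 := nH_conj q.1 q.2.1 q.2.2 (f P).2.2 r hr0 (Real.sq_sqrt (by positivity)).symm
  have e3 : Hmul (f P) q = Hmul ((f P).1, (f P).2.1, 0) (q.1, q.2.1, q.2.2 + (f P).2.2) := by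
    ext <;> simp [Hmul]; ring
  have c2 := nH_mul ((f P).1, (f P).2.1, 0) (q.1, q.2.1, q.2.2 + (f P).2.2)
  rw [← e3, ← eq1] at c2
  have c3 := nH_seg (f P).1 (f P).2.1
  have c4 := nH_t6 (f P)
  have c5 : |(f P).2.2| ≤ 7 * h ^ 4 := by
    have := nH_nonneg (f P)
    have h7 : nH (f P) ≤ 1.01 * h ^ 2 := b2.trans (by nlinarith [sq_nonneg h])
    have : nH (f P) ^ 2 ≤ (1.01 * h ^ 2) ^ 2 := by gcongr
    nlinarith [pow_pos hh 4]
  have c6 : |(f P).2.2| / (2 * r) ≤ 117 * h ^ 4 := by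
    rw [div_le_iff₀ (by linarith)]
    nlinarith [pow_pos hh 4]
  have eqq : nH q = nH (q.1, q.2.1, q.2.2) := rfl
  have d1 : ε * h ^ 2 ≤ h ^ 4 := by
    have := mul_le_mul_of_nonneg_left (show h ^ 2 ≤ 1 by linarith) hε0
    linarith
  have d2 : ε * s ≤ h ^ 4 := by
    have := mul_le_mul_of_nonneg_left hs.2 hε0
    linarith
  linarith


theorem lim0 {F G : ℝ → ℝ} (hF : Continuous F) (hG : Continuous G)
    (h : ∀ x, 0 < x → x ≤ 1/1000 → F x ≤ G x) : F 0 ≤ G 0 := by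
  have h1 : Filter.Tendsto F (nhdsWithin 0 (Set.Ioi 0)) (nhds (F 0)) :=
    (hF.tendsto 0).mono_left nhdsWithin_le_nhds
  have h2 : Filter.Tendsto G (nhdsWithin 0 (Set.Ioi 0)) (nhds (G 0)) :=
    (hG.tendsto 0).mono_left nhdsWithin_le_nhds
  refine le_of_tendsto_of_tendsto h1 h2 ?_
  have : Set.Ioc (0:ℝ) (1/1000) ∈ nhdsWithin (0:ℝ) (Set.Ioi 0) := Ioc_mem_nhdsGT (by norm_num)
  filter_upwards [this] with x hx
  exact h x hx.1 hx.2

theorem lineA_unit {ε h : ℝ} {f : H → H} (hf : Good ε f) (hε0 : 0 ≤ ε) (hh : 0 < h)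
    (hh1 : h ≤ 1/1000) (hε : ε ≤ h ^ 4) {v₁ v₂ : ℝ} (hv : v₁ ^ 2 + v₂ ^ 2 = 1) {p : H}
    (hp : p = f (h ^ 2 * v₁, h ^ 2 * v₂, 0)) :
    (1 - 240 * h ^ 2) * h ^ 4 ≤ p.1 ^ 2 + p.2.1 ^ 2 ∧
    p.1 ^ 2 + p.2.1 ^ 2 ≤ (1 + 3 * h ^ 2) * h ^ 4 ∧ |p.2.2| ≤ 260 * h * h ^ 4 := by
  have h0 := lineA0 hf hε0 hh hh1 hε hv
  rw [← hp] at h0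
  set m := Real.sqrt (p.1 ^ 2 + p.2.1 ^ 2) with hm
  have hm2 : m ^ 2 = p.1 ^ 2 + p.2.1 ^ 2 := Real.sq_sqrt (by positivity)
  have hn := hf.hi0 (h ^ 2 * v₁, h ^ 2 * v₂, 0)
  rw [← hp, nH_seg_eq, show (h ^ 2 * v₁) ^ 2 + (h ^ 2 * v₂) ^ 2 = (h ^ 2) ^ 2 by
      linear_combination (h ^ 2) ^ 2 * hv, Real.sqrt_sq (by positivity)] at hn
  have hh2 : h ^ 2 ≤ 1/1000000 := by
    calc h ^ 2 ≤ (1/1000) ^ 2 := by gcongr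
      _ ≤ _ := by norm_num
  have h2p : 0 < h ^ 2 := by positivity
  have hε2 : ε ≤ h ^ 2 := hε.trans (by nlinarith)
  have hε3 : ε ≤ 1/1000000 := hε2.trans hh2
  have hn0 := nH_nonneg p
  have hn1 : nH p ≤ 1.01 * h ^ 2 := by nlinarith
  have hn2 : nH p ≤ h ^ 2 + h ^ 4 := by nlinarith
  refine ⟨?_, ?_, ?_⟩
  · rw [← hm2]
    have : 0 ≤ h ^ 2 - 120 * h ^ 4 := by nlinarith
    calc (1 - 240 * h ^ 2) * h ^ 4 ≤ (h ^ 2 - 120 * h ^ 4) ^ 2 := by nlinarith [sq_nonneg (h ^ 4)]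
      _ ≤ m ^ 2 := by gcongr
  · have h1 : nH p ^ 2 ≤ (h ^ 2 + h ^ 4) ^ 2 := by gcongr
    have h3 : (h ^ 2 + h ^ 4) ^ 2 = (1 + 2 * h ^ 2 + h ^ 2 * h ^ 2) * h ^ 4 := by ring
    have h5 : (1 + 2 * h ^ 2 + h ^ 2 * h ^ 2) * h ^ 4 ≤ (1 + 3 * h ^ 2) * h ^ 4 := by
      apply mul_le_mul_of_nonneg_right _ (by positivity)
      nlinarith
    linarith [nH_zsq p]
  · have ht := nH_t p (inv_pos.2 hh)
    rw [← hm, inv_inv] at ht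
    have e1 : h⁻¹ * (nH p - m) ≤ 121 * h ^ 3 := by
      rw [inv_mul_le_iff₀ hh]; nlinarith
    have e2 : h * (2 * nH p) ≤ 2.02 * h ^ 3 := by nlinarith
    have e3 : 2 * nH p * (h⁻¹ * (nH p - m) + h * (2 * nH p)) ≤ 2 * (1.01 * h ^ 2) * (124 * h ^ 3) := by
      have : 0 ≤ h ^ 3 := by positivity
      have e4 : h⁻¹ * (nH p - m) + h * (2 * nH p) ≤ 124 * h ^ 3 := by linarith
      calc _ ≤ 2 * nH p * (124 * h ^ 3) := mul_le_mul_of_nonneg_left e4 (by linarith)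
        _ ≤ _ := mul_le_mul_of_nonneg_right (by linarith) (by linarith)
    have : 0 ≤ h ^ 5 := by positivity
    calc _ ≤ _ := ht
      _ ≤ _ := e3
      _ ≤ _ := by nlinarith

theorem Hdil_cancel {r : ℝ} (hr : 0 < r) (p : H) : Hdil r (Hdil r⁻¹ p) = p := by
  ext <;> simp [Hdil] <;> field_simp

theorem lineA1 {ε h : ℝ} {f : H → H} (hf : Good ε f) (hε0 : 0 ≤ ε) (hh : 0 < h)
    (hh1 : h ≤ 1/1000) (hε : ε ≤ h ^ 4) (w₁ w₂ : ℝ) {p : H}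
    (hp : p = f (w₁, w₂, 0)) :
    (1 - 240 * h ^ 2) * (w₁ ^ 2 + w₂ ^ 2) ≤ p.1 ^ 2 + p.2.1 ^ 2 ∧
    p.1 ^ 2 + p.2.1 ^ 2 ≤ (1 + 3 * h ^ 2) * (w₁ ^ 2 + w₂ ^ 2) ∧
    |p.2.2| ≤ 260 * h * (w₁ ^ 2 + w₂ ^ 2) := by
  rcases eq_or_lt_of_le (show 0 ≤ w₁ ^ 2 + w₂ ^ 2 by positivity) with hW | hW
  · have h1 : w₁ = 0 := by nlinarith [sq_nonneg w₁, sq_nonneg w₂]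
    have h2 : w₂ = 0 := by nlinarith [sq_nonneg w₁, sq_nonneg w₂]
    have : p = HO := by rw [hp, h1, h2]; exact hf.zero
    rw [this]; simp [HO, h1, h2]
  · set ρ := Real.sqrt (w₁ ^ 2 + w₂ ^ 2) with hρ
    have hρ0 : 0 < ρ := Real.sqrt_pos.2 hW
    have hρ2 : ρ ^ 2 = w₁ ^ 2 + w₂ ^ 2 := Real.sq_sqrt hW.le
    have hr : 0 < ρ / h ^ 2 := by positivity
    have hv : (w₁ / ρ) ^ 2 + (w₂ / ρ) ^ 2 = 1 := by
      rw [div_pow, div_pow, ← add_div, ← hρ2]; field_simp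
    obtain ⟨a1, a2, a3⟩ := lineA_unit (hf.dlf hr) hε0 hh hh1 hε hv rfl
    set g := dlf f (ρ / h ^ 2) (h ^ 2 * (w₁ / ρ), h ^ 2 * (w₂ / ρ), 0) with hg
    set r := ρ / h ^ 2 with hrdef
    have e : p = Hdil r g := by
      rw [hg, dlf, Hdil_cancel hr, hp]
      congr 1
      ext <;> simp [Hdil, hrdef] <;> field_simp
    have eW : w₁ ^ 2 + w₂ ^ 2 = r ^ 2 * h ^ 4 := by rw [← hρ2, hrdef]; field_simp
    have hr2 : 0 ≤ r ^ 2 := by positivity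
    have E1 : p.1 = r * g.1 := by rw [e]; rfl
    have E2 : p.2.1 = r * g.2.1 := by rw [e]; rfl
    have E3 : p.2.2 = r ^ 2 * g.2.2 := by rw [e]; rfl
    rw [E1, E2, E3, eW, abs_mul, abs_of_nonneg hr2]
    refine ⟨?_, ?_, ?_⟩
    · linarith [mul_le_mul_of_nonneg_left a1 hr2]
    · linarith [mul_le_mul_of_nonneg_left a2 hr2]
    · linarith [mul_le_mul_of_nonneg_left a3 hr2]

theorem lineA {ε h : ℝ} {f : H → H} (hf : Good ε f) (hε0 : 0 ≤ ε) (hh : 0 ≤ h)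
    (hh1 : h ≤ 1/1000) (hε : ε ≤ h ^ 4) (w₁ w₂ : ℝ) {p : H}
    (hp : p = f (w₁, w₂, 0)) :
    (1 - 240 * h ^ 2) * (w₁ ^ 2 + w₂ ^ 2) ≤ p.1 ^ 2 + p.2.1 ^ 2 ∧
    p.1 ^ 2 + p.2.1 ^ 2 ≤ (1 + 3 * h ^ 2) * (w₁ ^ 2 + w₂ ^ 2) ∧
    |p.2.2| ≤ 260 * h * (w₁ ^ 2 + w₂ ^ 2) := by
  rcases eq_or_lt_of_le hh with h0 | h0
  · have key : ∀ x : ℝ, 0 < x → x ≤ 1/1000 → _ := fun x hx hx1 =>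
      lineA1 hf hε0 hx hx1 (hε.trans (by rw [← h0, zero_pow (by norm_num)]; positivity)) w₁ w₂ hp
    rw [← h0]
    refine ⟨?_, ?_, ?_⟩
    · exact lim0 (F := fun x => (1 - 240 * x ^ 2) * (w₁ ^ 2 + w₂ ^ 2))
        (G := fun x => p.1 ^ 2 + p.2.1 ^ 2) (by fun_prop) (by fun_prop)
        (fun x hx hx1 => (key x hx hx1).1)
    · exact lim0 (F := fun x => p.1 ^ 2 + p.2.1 ^ 2)
        (G := fun x => (1 + 3 * x ^ 2) * (w₁ ^ 2 + w₂ ^ 2)) (by fun_prop) (by fun_prop)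
        (fun x hx hx1 => (key x hx hx1).2.1)
    · exact lim0 (F := fun x => |p.2.2|)
        (G := fun x => 260 * x * (w₁ ^ 2 + w₂ ^ 2)) (by fun_prop) (by fun_prop)
        (fun x hx hx1 => (key x hx hx1).2.2)
  · exact lineA1 hf hε0 h0 hh1 hε w₁ w₂ hp



theorem antip {ε h : ℝ} {g : H → H} (hg : Good ε g) (hε0 : 0 ≤ ε) (hh : 0 ≤ h)
    (hh1 : h ≤ 1/1000) (hε : ε ≤ h ^ 4) {v₁ v₂ : ℝ} (hv : v₁ ^ 2 + v₂ ^ 2 = 1)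
    {a b : H} (ha : a = g (v₁, v₂, 0)) (hb : b = g (-v₁, -v₂, 0)) :
    (a.1 + b.1) ^ 2 + (a.2.1 + b.2.1) ^ 2 ≤ 972 * h ^ 2 := by
  obtain ⟨-, a2, -⟩ := lineA hg hε0 hh hh1 hε _ _ ha
  obtain ⟨-, b2, -⟩ := lineA hg hε0 hh hh1 hε _ _ hb
  obtain ⟨c1, -, -⟩ := lineA (hg.trf (-v₁, -v₂, 0)) hε0 hh hh1 hε (2 * v₁) (2 * v₂) rfl
  have e : Hmul (-v₁, -v₂, 0) (2 * v₁, 2 * v₂, 0) = (v₁, v₂, 0) := by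
    ext <;> simp [Hmul] <;> ring
  simp only [trf, e, ← ha, ← hb] at c1
  simp only [Hmul, Hinv] at c1
  nlinarith

theorem half_dot {ε h : ℝ} {g : H → H} (hg : Good ε g) (hε0 : 0 ≤ ε) (hh : 0 ≤ h)
    (hh1 : h ≤ 1/1000) (hε : ε ≤ h ^ 4) {p₁ p₂ : ℝ} (hp : p₁ ^ 2 + p₂ ^ 2 ≤ (3 * h) ^ 2)
    (H0 : ∀ v₁ v₂ : ℝ, v₁ ^ 2 + v₂ ^ 2 = 1 →
      p₁ * (g (v₁, v₂, 0)).1 + p₂ * (g (v₁, v₂, 0)).2.1 ≤ 121 * h ^ 2)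
    {v₁ v₂ : ℝ} (hv : v₁ ^ 2 + v₂ ^ 2 = 1) :
    |p₁ * (g (v₁, v₂, 0)).1 + p₂ * (g (v₁, v₂, 0)).2.1| ≤ 217 * h ^ 2 := by
  have h1 := H0 v₁ v₂ hv
  have h2 := H0 (-v₁) (-v₂) (by linarith [neg_sq v₁, neg_sq v₂])
  have h3 := antip hg hε0 hh hh1 hε hv rfl rfl
  have h4 := abs_le.1 (cs_bound (A := 3 * h) (B := 32 * h) (by positivity) (by positivity) hp
    (h3.trans (by nlinarith [sq_nonneg h])))
  rw [abs_le]
  constructor <;> nlinarith [sq_nonneg h]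

theorem far {a b : H} {h : ℝ} (hh1 : h ≤ 1/100000)
    (ha : |a.2.2| ≤ 260 * h) (hb : |b.2.2| ≤ 260 * h)
    (hW : |b.1 * a.2.1 - a.1 * b.2.1| ≤ 115 / 10000)
    (hd : 14/10 ≤ nH (Hmul (Hinv a) b)) :
    1 ≤ (b.1 - a.1) ^ 2 + (b.2.1 - a.2.1) ^ 2 := by
  have h1 := nH_upper (b.1 - a.1) (b.2.1 - a.2.1)
    (b.2.2 - a.2.2 - 2 * (b.1 * a.2.1 - a.1 * b.2.1))
  have e : Hmul (Hinv a) b = (b.1 - a.1, b.2.1 - a.2.1,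
    b.2.2 - a.2.2 - 2 * (b.1 * a.2.1 - a.1 * b.2.1)) := by
    ext <;> simp [Hmul, Hinv] <;> ring
  rw [e] at hd
  have h2 : |b.2.2 - a.2.2 - 2 * (b.1 * a.2.1 - a.1 * b.2.1)| ≤ (17/100)^2 := by
    rw [abs_le] at *
    constructor <;> linarith
  have h3 : √|b.2.2 - a.2.2 - 2 * (b.1 * a.2.1 - a.1 * b.2.1)| ≤ 17/100 :=
    Real.sqrt_le_iff.2 ⟨by norm_num, h2⟩
  have h4 : 1 ≤ √((b.1 - a.1) ^ 2 + (b.2.1 - a.2.1) ^ 2) := by linarith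
  simpa using Real.one_le_sqrt.1 h4

theorem far2 {ε : ℝ} {g : H → H} (hg : Good ε g) (hε0 : 0 ≤ ε) (hε : ε ≤ 1/1000)
    {v₁ v₂ w₁ w₂ : ℝ} (hvw : (w₁ - v₁) ^ 2 + (w₂ - v₂) ^ 2 = 2) :
    14/10 ≤ nH (Hmul (Hinv (g (v₁, v₂, 0))) (g (w₁, w₂, 0))) := by
  have h1 := hg.lo (v₁, v₂, 0) (w₁, w₂, 0)
  have h2 := nH_zsq (Hmul (Hinv (v₁, v₂, 0)) (w₁, w₂, 0))
  have h0 := nH_nonneg (Hmul (Hinv (v₁, v₂, 0)) (w₁, w₂, 0))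
  generalize nH (Hmul (Hinv (v₁, v₂, 0)) (w₁, w₂, 0)) = n at *
  simp only [Hmul, Hinv] at h2
  have h3 : 2 ≤ n ^ 2 := by nlinarith
  have h4 : 1.41 ≤ n := by nlinarith
  refine le_trans ?_ h1
  rw [inv_mul_eq_div, le_div_iff₀ (by linarith)]
  linarith

theorem transv {ε h : ℝ} {g : H → H} (hg : Good ε g) (hε0 : 0 ≤ ε) (hh : 0 ≤ h)
    (hh1 : h ≤ 1/100000) (hε : ε ≤ h ^ 4) 
    {a b : H} (ha : a = g (1, 0, 0)) (hb : b = g (0, 1, 0)) :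
    1/100 ≤ |b.1 * a.2.1 - a.1 * b.2.1| := by
  by_contra! hc
  have hs : h ≤ 1/1000 := by linarith
  have hε1 : ε ≤ 1/1000 := by
    refine hε.trans ((pow_le_of_le_one hh (by linarith) (by norm_num)).trans hs)
  obtain ⟨a1, a2, a3⟩ := lineA hg hε0 hh hs hε _ _ ha
  obtain ⟨b1, b2, b3⟩ := lineA hg hε0 hh hs hε _ _ hb
  obtain ⟨c1, c2, c3⟩ := lineA hg hε0 hh hs hε (-1) 0 rfl
  have d := antip hg hε0 hh hs hε (by norm_num) ha rfl
  have f1 := far2 hg hε0 hε1 (v₁ := 1) (v₂ := 0) (w₁ := 0) (w₂ := 1) (by norm_num)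
  have f2 := far2 hg hε0 hε1 (v₁ := -1) (v₂ := 0) (w₁ := 0) (w₂ := 1) (by norm_num)
  rw [neg_zero] at d
  rw [← ha, ← hb] at f1
  rw [← hb] at f2
  set c := g (-1, 0, 0) with hcdef
  norm_num at a1 a2 a3 b1 b2 b3 c1 c2 c3
  have hh2 : h ^ 2 ≤ 1/10000000000 := by nlinarith
  have A1 : a.1 ^ 2 + a.2.1 ^ 2 ≤ (101/100) ^ 2 := by linarith
  have B1 : b.1 ^ 2 + b.2.1 ^ 2 ≤ (101/100) ^ 2 := by linarith
  have D : (a.1 + c.1) ^ 2 + (a.2.1 + c.2.1) ^ 2 ≤ (1/1000) ^ 2 := by linarith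
  have F1 := far hh1 a3 b3 (by linarith) f1
  have o := abs_le.1 (om_bound (by norm_num) (by norm_num) D B1)
  have F2 := far hh1 c3 b3 (by
    rw [abs_lt] at hc
    rw [abs_le]
    constructor <;> linarith) f2
  have k1 := abs_le.1 (cs_bound (by norm_num) (by norm_num) D B1)
  have k2 := abs_le.1 (cs_bound (by norm_num) (by norm_num) D A1)
  have S1 : a.1 * b.1 + a.2.1 * b.2.1 ≤ 6/10 := by linarith
  have S2 : -(6/10) ≤ a.1 * b.1 + a.2.1 * b.2.1 := by linarith
  have S3 : (a.1 * b.1 + a.2.1 * b.2.1) ^ 2 ≤ (6/10) ^ 2 := sq_le_sq' S2 S1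
  have W : (b.1 * a.2.1 - a.1 * b.2.1) ^ 2 ≤ (1/100) ^ 2 := by
    rw [← sq_abs]; exact pow_le_pow_left₀ (abs_nonneg _) hc.le 2
  have M : (99/100) * (99/100) ≤ (a.1 ^ 2 + a.2.1 ^ 2) * (b.1 ^ 2 + b.2.1 ^ 2) :=
    mul_le_mul (by linarith) (by linarith) (by norm_num) (by positivity)
  have I : (a.1 ^ 2 + a.2.1 ^ 2) * (b.1 ^ 2 + b.2.1 ^ 2) =
    (a.1 * b.1 + a.2.1 * b.2.1) ^ 2 + (b.1 * a.2.1 - a.1 * b.2.1) ^ 2 := by ring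
  rw [I] at M
  linarith

theorem fibre_unit {ε h : ℝ} {f : H → H} (hf : Good ε f) (hε0 : 0 ≤ ε) (hh : 0 ≤ h)
    (hh1 : h ≤ 1/100000) (hε : ε ≤ h ^ 4) {t : ℝ} (ht : |t| = h ^ 2)
    {p : H} (hp : p = f (0, 0, t)) :
    p.1 ^ 2 + p.2.1 ^ 2 ≤ (50000 * h ^ 2) ^ 2 := by
  have hs : h ≤ 1/1000 := by linarith
  have hh2 : h ^ 2 ≤ 1/10000000000 := by nlinarith
  have hε2 : ε ≤ h ^ 2 / 1000 := by
    have h4 : h ^ 4 = h ^ 2 * h ^ 2 := by ring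
    have := mul_le_mul_of_nonneg_left hh2 (sq_nonneg h)
    linarith [sq_nonneg h]
  have hP : p.1 ^ 2 + p.2.1 ^ 2 ≤ (3 * h) ^ 2 := by
    refine (nH_zsq p).trans (pow_le_pow_left₀ (nH_nonneg _) ?_ 2)
    have h1 := hf.hi0 (0, 0, t)
    have h2 := nH_vert t
    rw [ht, Real.sqrt_sq hh] at h2
    rw [hp]
    nlinarith [nH_nonneg (0, 0, t)]
  set g := trf f (0, 0, t) with hgdef
  have hg : Good ε g := hf.trf _
  have H0 : ∀ v₁ v₂ : ℝ, v₁ ^ 2 + v₂ ^ 2 = 1 →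
      p.1 * (g (v₁, v₂, 0)).1 + p.2.1 * (g (v₁, v₂, 0)).2.1 ≤ 121 * h ^ 2 := by
    intro v₁ v₂ hv
    obtain ⟨a1, -, -⟩ := lineA hg hε0 hh hs hε v₁ v₂ rfl
    have h1 := nH_conj v₁ v₂ 0 t 1 one_pos (by simpa using hv)
    rw [nH_seg_eq, hv, zero_add, ht, Real.sqrt_one] at h1
    have h2 := hf.hi0 (v₁, v₂, t)
    have e : f (v₁, v₂, t) = Hmul p (g (v₁, v₂, 0)) := by
      rw [hgdef, trf, hp, Hmul_inv_cancel]
      congr 1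
      ext <;> simp [Hmul]
    have h3 := nH_zsq (f (v₁, v₂, t))
    have h4 : nH (f (v₁, v₂, t)) ≤ 1 + 0.6 * h ^ 2 := by
      nlinarith [sq_nonneg h]
    have h5 : nH (f (v₁, v₂, t)) ^ 2 ≤ (1 + 0.6 * h ^ 2) ^ 2 :=
      pow_le_pow_left₀ (nH_nonneg _) h4 2
    replace h3 := h3.trans h5
    rw [e] at h3
    simp only [Hmul] at h3
    rw [hv] at a1
    have := mul_le_mul_of_nonneg_left hh2 (sq_nonneg h)
    linarith [sq_nonneg p.1, sq_nonneg p.2.1, sq_nonneg h]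
  have D1 := half_dot hg hε0 hh hs hε hP H0 (v₁ := 1) (v₂ := 0) (by norm_num)
  have D2 := half_dot hg hε0 hh hs hε hP H0 (v₁ := 0) (v₂ := 1) (by norm_num)
  have T := transv hg hε0 hh hh1 hε rfl rfl
  obtain ⟨-, a2, -⟩ := lineA hg hε0 hh hs hε 1 0 rfl
  obtain ⟨-, b2, -⟩ := lineA hg hε0 hh hs hε 0 1 rfl
  generalize g (1, 0, 0) = a at *
  generalize g (0, 1, 0) = b at *
  set w := b.1 * a.2.1 - a.1 * b.2.1 with hw
  set k := p.1 * a.1 + p.2.1 * a.2.1 with hk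
  set l := p.1 * b.1 + p.2.1 * b.2.1 with hl
  have E1 : p.1 * w = a.2.1 * l - b.2.1 * k := by rw [hw, hk, hl]; ring
  have E2 : p.2.1 * w = b.1 * k - a.1 * l := by rw [hw, hk, hl]; ring
  have K : k ^ 2 ≤ (217 * h ^ 2) ^ 2 := by
    rw [← sq_abs]; exact pow_le_pow_left₀ (abs_nonneg _) D1 2
  have L : l ^ 2 ≤ (217 * h ^ 2) ^ 2 := by
    rw [← sq_abs]; exact pow_le_pow_left₀ (abs_nonneg _) D2 2
  have W : (1/100) ^ 2 ≤ w ^ 2 := by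
    rw [← sq_abs w]; exact pow_le_pow_left₀ (by norm_num) T 2
  have E3 : (p.1 ^ 2 + p.2.1 ^ 2) * w ^ 2 ≤
      2 * ((a.1 ^ 2 + a.2.1 ^ 2) * l ^ 2 + (b.1 ^ 2 + b.2.1 ^ 2) * k ^ 2) := by
    have : (p.1 ^ 2 + p.2.1 ^ 2) * w ^ 2 = (p.1 * w) ^ 2 + (p.2.1 * w) ^ 2 := by ring
    rw [this, E1, E2]
    nlinarith [sq_nonneg (a.2.1 * l + b.2.1 * k), sq_nonneg (b.1 * k + a.1 * l)]
  have E4 : (a.1 ^ 2 + a.2.1 ^ 2) * l ^ 2 ≤ 1.01 * (217 * h ^ 2) ^ 2 :=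
    mul_le_mul (by linarith) L (by positivity) (by norm_num)
  have E5 : (b.1 ^ 2 + b.2.1 ^ 2) * k ^ 2 ≤ 1.01 * (217 * h ^ 2) ^ 2 :=
    mul_le_mul (by linarith) K (by positivity) (by norm_num)
  have E6 : (p.1 ^ 2 + p.2.1 ^ 2) * (1/100) ^ 2 ≤ (p.1 ^ 2 + p.2.1 ^ 2) * w ^ 2 :=
    mul_le_mul_of_nonneg_left W (by positivity)
  linarith [sq_nonneg (h ^ 2)]

theorem fibre1 {ε h : ℝ} {f : H → H} (hf : Good ε f) (hε0 : 0 ≤ ε) (hh : 0 < h)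
    (hh1 : h ≤ 1/100000) (hε : ε ≤ h ^ 4) (t : ℝ)
    {p : H} (hp : p = f (0, 0, t)) :
    p.1 ^ 2 + p.2.1 ^ 2 ≤ 50000 ^ 2 * h ^ 2 * |t| := by
  rcases eq_or_ne t 0 with h0 | h0
  · have : p = HO := by rw [hp, h0]; exact hf.zero
    rw [this, h0]; simp [HO]
  · set r := √|t| / h with hr
    have ht := abs_pos.2 h0
    have hs : 0 < √|t| := Real.sqrt_pos.2 ht
    have hr0 : 0 < r := by positivity
    have hr2 : r ^ 2 * h ^ 2 = |t| := by
      rw [hr, div_pow, Real.sq_sqrt ht.le]; field_simp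
    have key := fibre_unit (hf.dlf hr0) hε0 hh.le hh1 hε (t := t / r ^ 2) (by
      rw [abs_div, abs_of_pos (by positivity : (0:ℝ) < r ^ 2), ← hr2]; field_simp) rfl
    set g := dlf f r (0, 0, t / r ^ 2) with hg
    have e : p = Hdil r g := by
      rw [hg, dlf, Hdil_cancel hr0, hp]
      congr 1
      ext <;> simp [Hdil] ; field_simp
    have E1 : p.1 = r * g.1 := by rw [e]; rfl
    have E2 : p.2.1 = r * g.2.1 := by rw [e]; rfl
    rw [E1, E2, ← hr2]
    nlinarith [mul_le_mul_of_nonneg_left key (sq_nonneg r)]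

theorem lim0B {F G : ℝ → ℝ} (hF : Continuous F) (hG : Continuous G)
    (h : ∀ x, 0 < x → x ≤ 1/100000 → F x ≤ G x) : F 0 ≤ G 0 := by
  have := lim0 (F := fun x => F (x / 100)) (G := fun x => G (x / 100))
    (by fun_prop) (by fun_prop) (fun x h1 h2 => h _ (by positivity) (by linarith))
  simpa using this

theorem fibre {ε h : ℝ} {f : H → H} (hf : Good ε f) (hε0 : 0 ≤ ε) (hh : 0 ≤ h)
    (hh1 : h ≤ 1/100000) (hε : ε ≤ h ^ 4) (t : ℝ)
    {p : H} (hp : p = f (0, 0, t)) :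
    p.1 ^ 2 + p.2.1 ^ 2 ≤ 50000 ^ 2 * h ^ 2 * |t| := by
  rcases eq_or_lt_of_le hh with h0 | h0
  · rw [← h0]
    exact lim0B (F := fun x => p.1 ^ 2 + p.2.1 ^ 2)
        (G := fun x => 50000 ^ 2 * x ^ 2 * |t|) (by fun_prop) (by fun_prop)
        (fun x hx hx1 => fibre1 hf hε0 hx hx1
          (hε.trans (by rw [← h0, zero_pow (by norm_num)]; positivity)) t hp)
  · exact fibre1 hf hε0 h0 hh1 hε t hp


theorem pair_dot {ε h : ℝ} {f : H → H} (hf : Good ε f) (hε0 : 0 ≤ ε) (hh : 0 ≤ h)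
    (hh1 : h ≤ 1/100000) (hε : ε ≤ h ^ 4) {x y x' y' : ℝ}
    (hz : x ^ 2 + y ^ 2 ≤ 1) (hz' : x' ^ 2 + y' ^ 2 ≤ 1) {U V : H}
    (hU : U = f (x, y, 0)) (hV : V = f (x', y', 0)) :
    |U.1 * V.1 + U.2.1 * V.2.1 - (x * x' + y * y')| ≤ 171000 * h := by
  have hs : h ≤ 1/1000 := by linarith
  have hh2 : h ^ 2 ≤ h / 100000 := by nlinarith
  obtain ⟨U1, U2, -⟩ := lineA hf hε0 hh hs hε _ _ hU
  obtain ⟨V1, V2, -⟩ := lineA hf hε0 hh hs hε _ _ hV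
  set T := 2 * (x' * y - x * y') with hT
  have hTb : |T| ≤ 2 := by
    have := om_bound (a := x) (b := y) (c := x') (d := y') (A := 1) (B := 1) (by norm_num)
      (by norm_num) (by linarith) (by linarith)
    rw [hT, abs_mul, abs_two]; linarith
  set Q := f (x', y', T) with hQ
  obtain ⟨c1, c2, -⟩ := lineA (hf.trf (x, y, 0)) hε0 hh hs hε (x' - x) (y' - y) rfl
  have e : Hmul (x, y, 0) (x' - x, y' - y, 0) = (x', y', T) := by
    ext <;> simp [Hmul, hT] ; ring
  simp only [trf, e, ← hU, ← hQ] at c1 c2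
  simp only [Hmul, Hinv] at c1 c2
  have F := fibre (hf.trf (x', y', 0)) hε0 hh hh1 hε T rfl
  have e' : Hmul (x', y', 0) (0, 0, T) = (x', y', T) := by
    ext <;> simp [Hmul]
  simp only [trf, e', ← hV, ← hQ] at F
  simp only [Hmul, Hinv] at F
  have F1 : (-V.1 + Q.1) ^ 2 + (-V.2.1 + Q.2.1) ^ 2 ≤ (71000 * h) ^ 2 := by
    have := mul_le_mul_of_nonneg_left hTb (by positivity : 0 ≤ 50000 ^ 2 * h ^ 2)
    nlinarith [sq_nonneg h]
  have hw : (x' - x) ^ 2 + (y' - y) ^ 2 ≤ 4 := by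
    nlinarith [sq_nonneg (x' + x), sq_nonneg (y' + y)]
  have hw0 : 0 ≤ (x' - x) ^ 2 + (y' - y) ^ 2 := by positivity
  set w := (x' - x) ^ 2 + (y' - y) ^ 2 with hwdef
  have m1 := mul_le_mul_of_nonneg_left hw (sq_nonneg h)
  have m2 := mul_le_mul_of_nonneg_left hz (sq_nonneg h)
  have m3 := mul_le_mul_of_nonneg_left hz' (sq_nonneg h)
  have m1' := mul_nonneg (sq_nonneg h) hw0
  have m2' := mul_nonneg (sq_nonneg h) (by positivity : 0 ≤ x ^ 2 + y ^ 2)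
  have m3' := mul_nonneg (sq_nonneg h) (by positivity : 0 ≤ x' ^ 2 + y' ^ 2)
  have c3 : (-U.1 + Q.1) ^ 2 + (-U.2.1 + Q.2.1) ^ 2 ≤ 2.01 ^ 2 := by linarith
  have cs := abs_le.1 (cs_bound (by positivity) (by norm_num) F1 c3)
  have sq0 : 0 ≤ (-V.1 + Q.1) ^ 2 + (-V.2.1 + Q.2.1) ^ 2 := by positivity
  have I : (V.1 - U.1) ^ 2 + (V.2.1 - U.2.1) ^ 2 =
      (-U.1 + Q.1) ^ 2 + (-U.2.1 + Q.2.1) ^ 2 + ((-V.1 + Q.1) ^ 2 + (-V.2.1 + Q.2.1) ^ 2)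
      - 2 * ((-V.1 + Q.1) * (-U.1 + Q.1) + (-V.2.1 + Q.2.1) * (-U.2.1 + Q.2.1)) := by ring
  have J1 : (V.1 - U.1) ^ 2 + (V.2.1 - U.2.1) ^ 2 ≤ w + 340000 * h := by
    rw [I]; linarith
  have J2 : w - 340000 * h ≤ (V.1 - U.1) ^ 2 + (V.2.1 - U.2.1) ^ 2 := by
    rw [I]; linarith
  rw [hwdef] at J1 J2
  rw [abs_le]
  constructor <;> linarith

theorem div_close {a x m η δ : ℝ} (hη : 0 ≤ η) (hη1 : η ≤ 1/100) (hm : |m - 1| ≤ 2 * η)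
    (ha : |a * m - x| ≤ δ) (hx : |x| ≤ 1) : |a - x| ≤ (100/98) * (δ + 2 * η) := by
  have hm' := abs_le.1 hm
  have h1 : |(a - x) * m| ≤ δ + 2 * η := by
    have e : (a - x) * m = (a * m - x) + (-x) * (m - 1) := by ring
    rw [e]
    refine (abs_add_le _ _).trans (add_le_add ha ?_)
    rw [abs_mul, abs_neg]
    calc |x| * |m - 1| ≤ 1 * (2 * η) := mul_le_mul hx hm (abs_nonneg _) (by norm_num)
      _ = 2 * η := one_mul _
  rw [abs_mul, abs_of_pos (by linarith : 0 < m)] at h1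
  have h2 : |a - x| * (98/100) ≤ |a - x| * m :=
    mul_le_mul_of_nonneg_left (by linarith) (abs_nonneg _)
  linarith

theorem sq_close {m η δ : ℝ} (hη : 0 ≤ η) (hm : 0 ≤ m) (h : |m ^ 2 - 1| ≤ 2 * η) :
    |m - 1| ≤ 2 * η := by
  have e : m ^ 2 - 1 = (m - 1) * (m + 1) := by ring
  rw [e, abs_mul, abs_of_pos (by linarith : 0 < m + 1)] at h
  nlinarith [abs_nonneg (m - 1)]

set_option maxHeartbeats 1000000 in
theorem frame {a₁ a₂ b₁ b₂ η : ℝ} (hη : 0 ≤ η) (hη1 : η ≤ 1/100)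
    (ha : |a₁ ^ 2 + a₂ ^ 2 - 1| ≤ η) (hb : |b₁ ^ 2 + b₂ ^ 2 - 1| ≤ η)
    (hab : |a₁ * b₁ + a₂ * b₂| ≤ η) :
    ∃ c s σ : ℝ, c ^ 2 + s ^ 2 = 1 ∧ σ ^ 2 = 1 ∧ ∀ u₁ u₂ x y : ℝ, x ^ 2 + y ^ 2 ≤ 1 →
      |u₁ * a₁ + u₂ * a₂ - x| ≤ η → |u₁ * b₁ + u₂ * b₂ - y| ≤ η →
      (c * x - σ * s * y - u₁) ^ 2 + (s * x + σ * c * y - u₂) ^ 2 ≤ (10 * η) ^ 2 := by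
  have ha' := abs_le.1 ha
  have hb' := abs_le.1 hb
  set ρ := √(a₁ ^ 2 + a₂ ^ 2) with hρ
  have hρ2 : ρ ^ 2 = a₁ ^ 2 + a₂ ^ 2 := Real.sq_sqrt (by positivity)
  have hρ0 : 0 < ρ := Real.sqrt_pos.2 (by linarith)
  have hρ1 : |ρ - 1| ≤ 2 * η := sq_close (δ := 0) hη hρ0.le (by rw [hρ2]; linarith)
  have hρ1' := abs_le.1 hρ1
  obtain ⟨c, hc⟩ : ∃ c, c = a₁ / ρ := ⟨_, rfl⟩
  obtain ⟨s, hs⟩ : ∃ s, s = a₂ / ρ := ⟨_, rfl⟩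
  have A1 : a₁ = c * ρ := by rw [hc]; field_simp
  have A2 : a₂ = s * ρ := by rw [hs]; field_simp
  have hcs : c ^ 2 + s ^ 2 = 1 := by
    rw [hc, hs, div_pow, div_pow, ← add_div, ← hρ2]; field_simp
  set n := c * b₂ - s * b₁ with hn
  set k := c * b₁ + s * b₂ with hk
  have hkb : |k| ≤ 1.1 * η := by
    have : a₁ * b₁ + a₂ * b₂ = k * ρ := by rw [A1, A2, hk]; ring
    rw [this, abs_mul, abs_of_pos hρ0] at hab
    nlinarith [abs_nonneg k]
  have hkb' := abs_le.1 hkb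
  have hnk : n ^ 2 = b₁ ^ 2 + b₂ ^ 2 - k ^ 2 := by
    have : n ^ 2 + k ^ 2 = (c ^ 2 + s ^ 2) * (b₁ ^ 2 + b₂ ^ 2) := by rw [hn, hk]; ring
    rw [hcs] at this; linarith
  have hk2 : k ^ 2 ≤ η := by
    rw [← sq_abs]; nlinarith [abs_nonneg k]
  obtain ⟨σ, hσ, hσn⟩ : ∃ σ : ℝ, σ ^ 2 = 1 ∧ σ * n = |n| := by
    rcases le_total 0 n with h | h
    · exact ⟨1, by norm_num, by rw [abs_of_nonneg h]; ring⟩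
    · exact ⟨-1, by norm_num, by rw [abs_of_nonpos h]; ring⟩
  have hm1 : |(|n| - 1)| ≤ 2 * η := by
    refine sq_close (δ := 0) hη (abs_nonneg _) ?_
    rw [sq_abs, hnk, abs_le]
    constructor <;> linarith [sq_nonneg k]
  refine ⟨c, s, σ, hcs, hσ, ?_⟩
  intro u₁ u₂ x y hxy h1 h2
  have hx : |x| ≤ 1 := abs_le_of_sq_le_sq (by nlinarith [sq_nonneg y]) (by norm_num)
  have hy : |y| ≤ 1 := abs_le_of_sq_le_sq (by nlinarith [sq_nonneg x]) (by norm_num)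
  set α := u₁ * c + u₂ * s with hα
  set β := σ * (u₂ * c - u₁ * s) with hβ
  have B1 : |α - x| ≤ (100/98) * (η + 2 * η) := by
    refine div_close hη hη1 hρ1 ?_ hx
    have : α * ρ = u₁ * a₁ + u₂ * a₂ := by rw [A1, A2, hα]; ring
    rwa [this]
  have hα2 : |α| ≤ 1.1 := by
    have := abs_le.1 B1
    have := abs_le.1 hx
    rw [abs_le]; constructor <;> linarith
  have hαk : |α * k| ≤ 1.1 * (1.1 * η) := by
    rw [abs_mul]; exact mul_le_mul hα2 hkb (abs_nonneg _) (by norm_num)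
  have B2 : |β - y| ≤ (100/98) * (2.21 * η + 2 * η) := by
    refine div_close hη hη1 hm1 ?_ hy
    have e1 : β * |n| = u₁ * b₁ + u₂ * b₂ - α * k := by
      have : u₁ * b₁ + u₂ * b₂ = (c ^ 2 + s ^ 2) * (u₁ * b₁ + u₂ * b₂) := by rw [hcs]; ring
      have h3 : β * |n| = σ ^ 2 * ((u₂ * c - u₁ * s) * n) := by rw [← hσn, hβ]; ring
      rw [h3, hσ, this, hα, hk, hn]; ring
    rw [e1]
    have := abs_le.1 hαk
    have := abs_le.1 h2
    rw [abs_le]; constructor <;> linarith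
  have E : (c * x - σ * s * y - u₁) ^ 2 + (s * x + σ * c * y - u₂) ^ 2
      = (α - x) ^ 2 + (β - y) ^ 2 := by
    have e1 : (α - x) ^ 2 + (β - y) ^ 2 = (c ^ 2 + s ^ 2) * (u₁ ^ 2 + u₂ ^ 2) +
        (σ ^ 2 - 1) * (u₂ * c - u₁ * s) ^ 2 - 2 * α * x - 2 * β * y + x ^ 2 + y ^ 2 := by
      rw [hα, hβ]; ring
    have e2 : (c * x - σ * s * y - u₁) ^ 2 + (s * x + σ * c * y - u₂) ^ 2 =
        (c ^ 2 + s ^ 2) * (x ^ 2 + σ ^ 2 * y ^ 2) + u₁ ^ 2 + u₂ ^ 2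
        - 2 * α * x - 2 * β * y := by
      rw [hα, hβ]; ring
    rw [e1, e2, hcs, hσ]; ring
  rw [E]
  have C1 : (α - x) ^ 2 ≤ (4 * η) ^ 2 := by
    rw [← sq_abs]; exact pow_le_pow_left₀ (abs_nonneg _) (by linarith) 2
  have C2 : (β - y) ^ 2 ≤ (5 * η) ^ 2 := by
    rw [← sq_abs]; exact pow_le_pow_left₀ (abs_nonneg _) (by linarith) 2
  nlinarith [sq_nonneg η]

theorem unit_case {ε k : ℝ} {f : H → H} (hf : Good ε f) (hk : 0 ≤ k) (hk1 : k ^ 4 ≤ 1/100000000)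
    (hε : ε = k ^ 16) :
    ∃ c s σ : ℝ, c ^ 2 + s ^ 2 = 1 ∧ σ ^ 2 = 1 ∧ ∀ x y : ℝ, x ^ 2 + y ^ 2 ≤ 1 →
      nH (Hmul (Hinv (f (x, y, 0))) (c * x - σ * s * y, s * x + σ * c * y, 0)) ≤ 10 ^ 7 * k := by
  obtain ⟨h, hh⟩ : ∃ h, h = k ^ 4 := ⟨_, rfl⟩
  have hε0 : 0 ≤ ε := by rw [hε]; positivity
  have hε4 : ε ≤ h ^ 4 := by rw [hε, hh]; apply le_of_eq; ring
  have hh0 : 0 ≤ h := by rw [hh]; positivity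
  rw [← hh] at hk1
  have hs : h ≤ 1/100000 := by linarith
  have D : ∀ x y x' y' : ℝ, x ^ 2 + y ^ 2 ≤ 1 → x' ^ 2 + y' ^ 2 ≤ 1 → _ :=
    fun x y x' y' h1 h2 => pair_dot hf hε0 hh0 hs hε4 (x := x) (y := y) (x' := x') (y' := y')
      h1 h2 rfl rfl
  have d11 := D 1 0 1 0 (by norm_num) (by norm_num)
  have d12 := D 1 0 0 1 (by norm_num) (by norm_num)
  have d22 := D 0 1 0 1 (by norm_num) (by norm_num)
  have dx : ∀ x y : ℝ, x ^ 2 + y ^ 2 ≤ 1 → _ := fun x y hxy => D x y 1 0 hxy (by norm_num)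
  have dy : ∀ x y : ℝ, x ^ 2 + y ^ 2 ≤ 1 → _ := fun x y hxy => D x y 0 1 hxy (by norm_num)
  generalize f (1, 0, 0) = a at *
  generalize f (0, 1, 0) = b at *
  obtain ⟨c, s, σ, h1, h2, h3⟩ := frame (a₁ := a.1) (a₂ := a.2.1) (b₁ := b.1) (b₂ := b.2.1)
    (η := 171000 * h) (by positivity) (by linarith)
    (by convert d11 using 2; ring) (by convert d22 using 2; ring) (by convert d12 using 2; ring)
  refine ⟨c, s, σ, h1, h2, ?_⟩
  intro x y hxy
  have h4 := h3 (f (x, y, 0)).1 (f (x, y, 0)).2.1 x y hxy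
    (by convert dx x y hxy using 2; ring) (by convert dy x y hxy using 2; ring)
  obtain ⟨-, -, l3⟩ := lineA hf hε0 hh0 (by linarith) hε4 x y rfl
  set u := f (x, y, 0) with hu
  set p := c * x - σ * s * y with hp
  set q := s * x + σ * c * y with hq
  have hpq : p ^ 2 + q ^ 2 ≤ 1 ^ 2 := by
    have : p ^ 2 + q ^ 2 = (c ^ 2 + s ^ 2) * (x ^ 2 + σ ^ 2 * y ^ 2) := by rw [hp, hq]; ring
    rw [this, h1, h2]; linarith
  have om := abs_le.1 (om_bound (by positivity) (by norm_num) h4 hpq)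
  have e : Hmul (Hinv u) (p, q, 0) = (p - u.1, q - u.2.1, -u.2.2 + 2 * (u.1 * q - p * u.2.1)) := by
    ext <;> simp [Hmul, Hinv] <;> ring
  rw [e]
  refine (nH_upper _ _ _).trans ?_
  have s1 : √((p - u.1) ^ 2 + (q - u.2.1) ^ 2) ≤ 1710000 * h :=
    Real.sqrt_le_iff.2 ⟨by positivity, by linarith⟩
  have l4 : |u.2.2| ≤ 260 * h := by
    have := mul_le_mul_of_nonneg_left hxy (by positivity : 0 ≤ 260 * h)
    linarith
  have l5 := abs_le.1 l4
  have hk0 : k ≤ 1 := by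
    by_contra! hc
    have := one_le_pow₀ (n := 4) hc.le
    linarith
  have hhk : h ≤ k ^ 2 := by rw [hh]; exact pow_le_pow_of_le_one hk hk0 (by norm_num)
  have hkk : k ^ 2 ≤ k := pow_le_of_le_one hk hk0 (by norm_num)
  have s2 : √|-u.2.2 + 2 * (u.1 * q - p * u.2.1)| ≤ 2000 * k := by
    refine Real.sqrt_le_iff.2 ⟨by positivity, ?_⟩
    rw [abs_le]
    constructor <;> nlinarith
  linarith


theorem main_aux {ε k : ℝ} {f : H → H} (hf : Good ε f) (hk : 0 ≤ k) (hk1 : k ^ 4 ≤ 1/100000000)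
    (hε : ε = k ^ 16) {R : ℝ} (hR : 0 < R) :
    ∃ A : Matrix (Fin 2) (Fin 2) ℝ, A.transpose * A = 1 ∧
          ∀ x y : ℝ, Real.sqrt (x ^ 2 + y ^ 2) ≤ R →
            dH (f (x, y, 0)) (A 0 0 * x + A 0 1 * y, A 1 0 * x + A 1 1 * y, 0)
              ≤ 10 ^ 7 * k * R := by
  obtain ⟨c, s, σ, h1, h2, h3⟩ := unit_case (hf.dlf hR) hk hk1 hε
  refine ⟨!![c, -(σ * s); s, σ * c], ?_, ?_⟩
  · ext i j
    fin_cases i <;> fin_cases j <;> simp [Matrix.mul_apply, Fin.sum_univ_two]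
    · linarith
    · ring
    · ring
    · linear_combination h2 + σ ^ 2 * h1
  · intro x y hxy
    have hxy2 : x ^ 2 + y ^ 2 ≤ R ^ 2 := (Real.sqrt_le_iff.1 hxy).2
    have h4 := h3 (x / R) (y / R) (by
      rw [div_pow, div_pow, ← add_div]; exact (div_le_one (by positivity)).2 hxy2)
    have e : f (x, y, 0) = Hdil R (dlf f R (x / R, y / R, 0)) := by
      rw [dlf, Hdil_cancel hR]
      congr 1
      ext <;> simp [Hdil] <;> field_simp
    have e2 : ((!![c, -(σ * s); s, σ * c] : Matrix (Fin 2) (Fin 2) ℝ) 0 0 * x +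
        (!![c, -(σ * s); s, σ * c] : Matrix (Fin 2) (Fin 2) ℝ) 0 1 * y,
        (!![c, -(σ * s); s, σ * c] : Matrix (Fin 2) (Fin 2) ℝ) 1 0 * x +
        (!![c, -(σ * s); s, σ * c] : Matrix (Fin 2) (Fin 2) ℝ) 1 1 * y, (0:ℝ)) =
        Hdil R (c * (x / R) - σ * s * (y / R), s * (x / R) + σ * c * (y / R), 0) := by
      ext <;> simp [Hdil] <;> field_simp <;> ring
    rw [e2, dH_nH, e, ← Hdil_inv, ← Hdil_mul, nH_dil R hR]
    linarith [mul_le_mul_of_nonneg_left h4 hR.le]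

/-- Theorem B, biLipschitz image of a horizontal plane.
There are `ε₀ > 0` and `C > 0` such that if `f` is a `(1+ε)`-biLipschitz self map
of `ℍ` with `ε ≤ ε₀` and `f(O) = O`, then for any `R > 0` there is `A ∈ O(2)`
such that `d(f(z;0), (Az;0)) ≤ C ε^{1/16} R` for every `z` with `|z| ≤ R`. -/
theorem statement3 :
    ∃ ε₀ > (0:ℝ), ∃ C > (0:ℝ),
      ∀ ε : ℝ, 0 ≤ ε → ε ≤ ε₀ →
      ∀ f : H → H, IsBiLip ε f → f HO = HO →
      ∀ R : ℝ, 0 < R →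
        ∃ A : Matrix (Fin 2) (Fin 2) ℝ, A.transpose * A = 1 ∧
          ∀ x y : ℝ, Real.sqrt (x ^ 2 + y ^ 2) ≤ R →
            dH (f (x, y, 0)) (A 0 0 * x + A 0 1 * y, A 1 0 * x + A 1 1 * y, 0)
              ≤ C * ε ^ ((1:ℝ)/16) * R := by
  refine ⟨(1 / 100000000) ^ 4, by positivity, 10 ^ 7, by norm_num, ?_⟩
  intro ε hε0 hε f hf h0 R hR
  have hg : Good ε f := by
    refine ⟨fun P Q => ?_, fun P Q => ?_, h0⟩
    · rw [← dH_nH, ← dH_nH]; exact (hf P Q).1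
    · rw [← dH_nH, ← dH_nH]; exact (hf P Q).2
  have hk : 0 ≤ ε ^ ((1:ℝ)/16) := Real.rpow_nonneg hε0 _
  have hk16 : ε = (ε ^ ((1:ℝ)/16)) ^ 16 := by
    rw [← Real.rpow_natCast, ← Real.rpow_mul hε0]; norm_num
  have hk4 : (ε ^ ((1:ℝ)/16)) ^ 4 ≤ 1 / 100000000 := by
    by_contra! hc
    have := pow_lt_pow_left₀ hc (by norm_num) (n := 4) (by norm_num)
    rw [← pow_mul] at this
    norm_num only at this hε hk16
    linarith
  exact main_aux hg hk hk4 hk16 hR
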